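/- There exists a set W of prime numbers of natural density one such that ℤ is definable over the ring O_{ℚ,W} by a ∀∃-formula with a single universal quantifier: there exist k ∈ ℕ and a polynomial F with integer coefficients in 2 + k variables such that for every t ∈ O_{ℚ,W}, t ∈ ℤ if and only if for all x ∈ O_{ℚ,W} there exist y₁,…,y_k ∈ O_{ℚ,W} with F(t, x, y₁,…,y_k) = 0. -/

import Mathlib

/-- The subring `O_{ℚ,S}` of `ℚ` consisting of all rationals whose reduced denominator
is divisible only by primes belonging to `S`. -/
def ringOfPrimes (S : Set ℕ) : Subring ℚ where
  carrier := {x : ℚ | ∀ p : ℕ, p.Prime → p ∣ x.den → p ∈ S}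
  zero_mem' := by intro p hp hdvd; rw [Rat.den_zero] at hdvd; exact absurd (Nat.dvd_one.mp hdvd) hp.ne_one
  one_mem' := by intro p hp hdvd; rw [Rat.den_one] at hdvd; exact absurd (Nat.dvd_one.mp hdvd) hp.ne_one
  add_mem' := by
    intro x y hx hy p hp hdvd
    have := hdvd.trans (Rat.add_den_dvd x y)
    rcases (Nat.Prime.dvd_mul hp).1 this with h | h
    · exact hx p hp h
    · exact hy p hp h
  mul_mem' := by
    intro x y hx hy p hp hdvd
    have := hdvd.trans (Rat.mul_den_dvd x y)
    rcases (Nat.Prime.dvd_mul hp).1 this with h | h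
    · exact hx p hp h
    · exact hy p hp h
  neg_mem' := by
    intro x hx p hp hdvd
    rw [Rat.neg_den] at hdvd
    exact hx p hp hdvd

open scoped Classical in
/-- The finset of primes `p ≤ X` belonging to `S`. -/
noncomputable def primesUpTo (S : Set ℕ) (X : ℕ) : Finset ℕ :=
  (Finset.range (X + 1)).filter fun p => p.Prime ∧ p ∈ S

/-- A set `S` of primes has natural density `d` if
`#{p ∈ S : p ≤ X} / #{p prime : p ≤ X} → d` as `X → ∞`. -/
def HasNatDensity (S : Set ℕ) (d : ℝ) : Prop :=
  Filter.Tendsto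
    (fun X : ℕ => ((primesUpTo S X).card : ℝ) / ((primesUpTo Set.univ X).card : ℝ))
    Filter.atTop (nhds d)

/-- The conic `a x² + b y² = z²` has a nontrivial point over `F`. -/
def HasConicPoint {F : Type*} [Field F] (a b : F) : Prop :=
  ∃ x y z : F, ¬(x = 0 ∧ y = 0 ∧ z = 0) ∧ a * x ^ 2 + b * y ^ 2 = z ^ 2

namespace HasConicPoint

variable {F : Type*} [Field F] {a b c t : F}

theorem symm (h : HasConicPoint a b) : HasConicPoint b a := by
  obtain ⟨x, y, z, hne, h⟩ := h
  exact ⟨y, x, z, by tauto, by rw [← h]; ring⟩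

theorem of_isSquare_left (h : IsSquare a) : HasConicPoint a b := by
  obtain ⟨r, rfl⟩ := h
  exact ⟨1, 0, r, by simp, by ring⟩

theorem of_isSquare_right (h : IsSquare b) : HasConicPoint a b :=
  (of_isSquare_left h).symm

theorem mul_sq_right_iff {s : F} (hs : s ≠ 0) :
    HasConicPoint a (b * s ^ 2) ↔ HasConicPoint a b := by
  constructor
  · rintro ⟨x, y, z, hne, h⟩
    refine ⟨x, s * y, z, ?_, by rw [← h]; ring⟩
    simpa [hs] using hne
  · rintro ⟨x, y, z, hne, h⟩
    refine ⟨x, y / s, z, ?_, ?_⟩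
    · simpa [hs] using hne
    · rw [← h]; field_simp

theorem mul_sq_left_iff {s : F} (hs : s ≠ 0) :
    HasConicPoint (a * s ^ 2) b ↔ HasConicPoint a b :=
  ⟨fun h => ((mul_sq_right_iff hs).1 h.symm).symm,
    fun h => ((mul_sq_right_iff hs).2 h.symm).symm⟩

/-- The descent step in the proof of the Hasse principle for conics. -/
theorem of_mul_eq_sq_sub (hb : b ≠ 0) (hbc : b * c = t ^ 2 - a)
    (h : HasConicPoint a b) : HasConicPoint a c := by
  obtain ⟨x, y, z, hne, h⟩ := h
  by_cases hy : y = 0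
  · subst hy
    exact ⟨x, 0, z, by tauto, by rw [← h]; ring⟩
  by_cases hsq : IsSquare a
  · exact of_isSquare_left hsq
  refine ⟨t * x + z, b * y, t * z + a * x, fun h0 => ?_, ?_⟩
  · exact (mul_ne_zero hb hy) h0.2.1
  · have : b ^ 2 * c * y ^ 2 = (t ^ 2 - a) * (z ^ 2 - a * x ^ 2) := by
      rw [← hbc, ← h]; ring
    linear_combination this

end HasConicPoint

namespace Padic

variable {p : ℕ} [hp : Fact p.Prime]

theorem isSquare_of_norm_sub_one_lt {y : ℚ_[p]} (hy : ‖y - 1‖ < ‖(2 : ℚ_[p])‖ ^ 2) :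
    IsSquare y := by
  have h2 : ‖(2 : ℚ_[p])‖ ≤ 1 := by simpa using Padic.norm_int_le_one (p := p) 2
  have hy1 : ‖y - 1‖ < 1 := hy.trans_le (pow_le_one₀ (norm_nonneg _) h2)
  have hyn : ‖y‖ ≤ 1 := by
    have := Padic.nonarchimedean (y - 1) 1
    simp only [sub_add_cancel, norm_one] at this
    exact this.trans (max_le hy1.le le_rfl)
  let Y : ℤ_[p] := ⟨y, hyn⟩
  have key := hensels_lemma (p := p) (R := ℤ_[p]) (F := Polynomial.X ^ 2 - Polynomial.C Y) (a := 1)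
    (by
      have h1 : ‖(2 : ℤ_[p])‖ = ‖(2 : ℚ_[p])‖ := rfl
      have h3 : ‖(1 : ℤ_[p]) - Y‖ = ‖y - 1‖ := by
        rw [norm_sub_rev]; rfl
      simp [h1, h3, one_add_one_eq_two]
      simpa using hy)
  obtain ⟨z, hz, -⟩ := key
  refine ⟨z, ?_⟩
  have : z ^ 2 - Y = 0 := by simpa using hz
  have h4 : Y = z * z := by rw [← sq]; exact (sub_eq_zero.1 this).symm
  have := congrArg (fun w : ℤ_[p] => (w : ℚ_[p])) h4
  simpa [Y] using this

theorem norm_two_of_ne (hp2 : p ≠ 2) : ‖(2 : ℚ_[p])‖ = 1 := by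
  have := (Padic.norm_intCast_eq_one_iff (p := p) (z := 2)).2 (by
    have : Nat.Coprime 2 p := (Nat.coprime_primes Nat.prime_two hp.out).2 (Ne.symm hp2)
    exact_mod_cast Nat.isCoprime_iff_coprime.2 this)
  simpa using this

theorem isSquare_of_norm_sub_one_lt_one (hp2 : p ≠ 2) {y : ℚ_[p]} (hy : ‖y - 1‖ < 1) :
    IsSquare y :=
  isSquare_of_norm_sub_one_lt (by rw [norm_two_of_ne hp2]; simpa using hy)

theorem isSquare_mul_sq_iff {a s : ℚ_[p]} (hs : s ≠ 0) : IsSquare (a * s ^ 2) ↔ IsSquare a := by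
  constructor
  · rintro ⟨r, hr⟩
    refine ⟨r / s, ?_⟩
    field_simp
    linear_combination hr
  · rintro ⟨r, rfl⟩
    exact ⟨r * s, by ring⟩

theorem hasConicPoint_of_norm_eq_one (hp2 : p ≠ 2) {a b : ℚ_[p]} (ha : ‖a‖ = 1) (hb : ‖b‖ = 1) :
    HasConicPoint a b := by
  let A : ℤ_[p] := ⟨a, ha.le⟩
  let B : ℤ_[p] := ⟨b, hb.le⟩
  have unit_ne : ∀ C : ℤ_[p], ‖C‖ = 1 → PadicInt.toZMod C ≠ 0 := fun C hC h0 => by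
    have : C ∈ RingHom.ker (PadicInt.toZMod (p := p)) := h0
    rw [PadicInt.ker_toZMod, IsLocalRing.mem_maximalIdeal, PadicInt.mem_nonunits, hC] at this
    exact lt_irrefl _ this
  have hA := unit_ne A ha
  have hB := unit_ne B hb
  obtain ⟨x, y, hxy⟩ := FiniteField.exists_root_sum_quadratic (R := ZMod p)
    (f := Polynomial.C (PadicInt.toZMod A) * Polynomial.X ^ 2)
    (g := Polynomial.C (PadicInt.toZMod B) * Polynomial.X ^ 2 + Polynomial.C 0 * Polynomial.X
      + Polynomial.C (-1))
    (Polynomial.degree_C_mul_X_pow _ hA) (Polynomial.degree_quadratic hB)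
    (by rw [ZMod.card]; exact hp.out.eq_two_or_odd.resolve_left hp2)
  obtain ⟨X, rfl⟩ := ZMod.ringHom_surjective (PadicInt.toZMod (p := p)) x
  obtain ⟨Y, rfl⟩ := ZMod.ringHom_surjective (PadicInt.toZMod (p := p)) y
  have hker : A * X ^ 2 + B * Y ^ 2 - 1 ∈ RingHom.ker (PadicInt.toZMod (p := p)) := by
    rw [RingHom.mem_ker]
    simp at hxy
    simp only [map_sub, map_add, map_mul, map_pow, map_one]
    linear_combination hxy
  rw [PadicInt.ker_toZMod, IsLocalRing.mem_maximalIdeal, PadicInt.mem_nonunits,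
    PadicInt.norm_def] at hker
  have hlt : ‖(a * (X : ℚ_[p]) ^ 2 + b * (Y : ℚ_[p]) ^ 2) - 1‖ < 1 := hker
  obtain ⟨z, hz⟩ := isSquare_of_norm_sub_one_lt_one hp2 hlt
  refine ⟨X, Y, z, fun h0 => ?_, by rw [hz, sq]⟩
  rw [h0.1, h0.2.1] at hlt
  norm_num at hlt

theorem isSquare_intCast (hp2 : p ≠ 2) {n : ℤ} (hn : ¬(p : ℤ) ∣ n) (h : IsSquare (n : ZMod p)) :
    IsSquare (n : ℚ_[p]) := by
  obtain ⟨r, hr⟩ := h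
  obtain ⟨s, rfl⟩ := ZMod.intCast_surjective r
  have hdvd : (p : ℤ) ∣ n - s * s := by
    rw [← ZMod.intCast_zmod_eq_zero_iff_dvd]; push_cast; rw [hr, sub_self]
  have hs : ¬(p : ℤ) ∣ s := fun hs => hn (by
    have := dvd_add hdvd (hs.mul_left s)
    simpa using this)
  have hsn : ‖(s : ℚ_[p])‖ = 1 := by
    by_contra h1
    exact hs (Padic.norm_intCast_lt_one_iff.1 (lt_of_le_of_ne (Padic.norm_int_le_one s) h1))
  have hs0 : (s : ℚ_[p]) ≠ 0 := fun h0 => by simp [h0] at hsn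
  have : IsSquare ((n : ℚ_[p]) / (s : ℚ_[p]) ^ 2) := by
    apply isSquare_of_norm_sub_one_lt_one hp2
    have : (n : ℚ_[p]) / (s : ℚ_[p]) ^ 2 - 1 = ((n - s * s : ℤ) : ℚ_[p]) / (s : ℚ_[p]) ^ 2 := by
      push_cast; field_simp
    rw [this, norm_div, norm_pow, hsn, one_pow, div_one]
    exact Padic.norm_intCast_lt_one_iff.2 hdvd
  have := (isSquare_mul_sq_iff hs0).2 this
  rwa [div_mul_cancel₀ _ (pow_ne_zero 2 hs0)] at this

theorem not_dvd_of_isSquare_of_squarefree {n : ℤ} (hn : Squarefree n) (h : IsSquare (n : ℚ_[p])) :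
    ¬(p : ℤ) ∣ n := by
  obtain ⟨r, hr⟩ := h
  intro hd
  have hlt : ‖r‖ < 1 := by
    have := Padic.norm_intCast_lt_one_iff.2 hd
    rw [hr, norm_mul] at this
    nlinarith [norm_nonneg r]
  have hle : ‖r‖ ≤ (p : ℝ) ^ (-1 : ℤ) := by
    rw [Padic.norm_le_pow_iff_norm_lt_pow_add_one]; simpa using hlt
  have h2 : ‖(n : ℚ_[p])‖ ≤ (p : ℝ) ^ (-(2 : ℕ) : ℤ) := by
    rw [hr, norm_mul]
    calc ‖r‖ * ‖r‖ ≤ (p : ℝ) ^ (-1 : ℤ) * (p : ℝ) ^ (-1 : ℤ) :=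
          mul_le_mul hle hle (norm_nonneg _) ((norm_nonneg _).trans hle)
      _ = (p : ℝ) ^ (-(2 : ℕ) : ℤ) := by
          rw [← zpow_add₀ (by exact_mod_cast hp.out.ne_zero)]; norm_num
  have hdd := (Padic.norm_int_le_pow_iff_dvd n 2).1 h2
  have := hn (p : ℤ) (by rw [← sq]; exact_mod_cast hdd)
  exact hp.out.not_isUnit (Int.ofNat_isUnit.1 this)

theorem exists_padicInt_mul_self {n : ℤ} (h : IsSquare (n : ℚ_[p])) :
    ∃ r : ℤ_[p], (n : ℤ_[p]) = r * r := by
  obtain ⟨r, hr⟩ := h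
  have hle : ‖r‖ ≤ 1 := by
    have := Padic.norm_int_le_one (p := p) n
    rw [hr, norm_mul] at this
    nlinarith [norm_nonneg r]
  refine ⟨⟨r, hle⟩, PadicInt.ext ?_⟩
  exact (PadicInt.coe_intCast n).trans hr

theorem isSquare_zmod_of_isSquare {n : ℤ} (h : IsSquare (n : ℚ_[p])) : IsSquare (n : ZMod p) := by
  obtain ⟨r, hr⟩ := exists_padicInt_mul_self h
  exact ⟨PadicInt.toZMod r, by rw [← map_mul, ← hr, map_intCast]⟩

theorem emod_eight_of_isSquare_of_squarefree {n : ℤ} (hn : Squarefree n)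
    (h : IsSquare (n : ℚ_[2])) : n % 8 = 1 := by
  have hodd := not_dvd_of_isSquare_of_squarefree hn h
  obtain ⟨r, hr⟩ := exists_padicInt_mul_self h
  have h8 : (n : ZMod (2 ^ 3)) = PadicInt.toZModPow 3 r * PadicInt.toZModPow 3 r := by
    rw [← map_mul, ← hr, map_intCast]
  have key : ∀ s : ZMod (2 ^ 3), (s * s = 0 ∨ s * s = 1 ∨ s * s = 4) := by decide
  have h2 : ¬ (2 : ℤ) ∣ n := by exact_mod_cast hodd
  have cast : ∀ k : ℤ, (n : ZMod (2 ^ 3)) = (k : ZMod (2 ^ 3)) → n % 8 = k % 8 := fun k hk => by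
    have := (ZMod.intCast_eq_intCast_iff n k (2 ^ 3)).1 hk
    exact this
  rcases key (PadicInt.toZModPow 3 r) with h0 | h0 | h0 <;> rw [h0] at h8
  · have := cast 0 (by simpa using h8); omega
  · have := cast 1 (by simpa using h8); omega
  · have := cast 4 (by simpa using h8); omega

end Padic

theorem Int.exists_sq_mul_squarefree {n : ℤ} (hn : n ≠ 0) :
    ∃ m s : ℤ, Squarefree m ∧ s ≠ 0 ∧ n = m * s ^ 2 := by
  obtain ⟨a, b, hab, ha⟩ := Nat.sq_mul_squarefree n.natAbs
  have hb : b ≠ 0 := by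
    rintro rfl
    exact hn (Int.natAbs_eq_zero.1 (by rw [← hab]; simp))
  have hab' : ((b : ℤ)) ^ 2 * a = |n| := by rw [Int.abs_eq_natAbs]; exact_mod_cast hab
  have hsq : Squarefree (a : ℤ) := Int.squarefree_natCast.2 ha
  rcases abs_choice n with h | h
  · exact ⟨a, b, hsq, by exact_mod_cast hb, by rw [← h, ← hab']; ring⟩
  · refine ⟨-a, b, ?_, by exact_mod_cast hb, by linear_combination hab' + h⟩
    rwa [← Int.squarefree_natAbs, Int.natAbs_neg, Int.squarefree_natAbs]

theorem Rat.exists_squarefree_mul_sq {r : ℚ} (hr : r ≠ 0) :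
    ∃ (m : ℤ) (s : ℚ), Squarefree m ∧ s ≠ 0 ∧ r = m * s ^ 2 := by
  have hd : (r.den : ℤ) ≠ 0 := by exact_mod_cast r.den_ne_zero
  obtain ⟨m, s, hm, hs, h⟩ :=
    Int.exists_sq_mul_squarefree (mul_ne_zero (Rat.num_ne_zero.2 hr) hd)
  have hd' : (r.den : ℚ) ≠ 0 := by exact_mod_cast r.den_ne_zero
  have hs' : (s : ℚ) ≠ 0 := by exact_mod_cast hs
  refine ⟨m, s / r.den, hm, div_ne_zero hs' hd', ?_⟩
  have h' : (r.num : ℚ) * r.den = m * s ^ 2 := by exact_mod_cast h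
  nth_rewrite 1 [← Rat.num_div_den r]
  field_simp
  linear_combination h'

theorem ZMod.isSquare_two (x : ZMod 2) : IsSquare x := by
  revert x
  decide

theorem Int.exists_dvd_sq_sub {a b : ℤ} (hb : Squarefree b)
    (h : ∀ p : ℕ, p.Prime → (p : ℤ) ∣ b → ∃ t : ℤ, (p : ℤ) ∣ t ^ 2 - a) :
    ∃ t : ℤ, b ∣ t ^ 2 - a := by
  suffices H : ∀ n : ℕ, Squarefree n →
      (∀ p : ℕ, p.Prime → p ∣ n → ∃ t : ℤ, (p : ℤ) ∣ t ^ 2 - a) →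
      ∃ t : ℤ, (n : ℤ) ∣ t ^ 2 - a by
    obtain ⟨t, ht⟩ := H b.natAbs (Int.squarefree_natAbs.2 hb)
      (fun p hp hpn => h p hp (Int.natCast_dvd.2 hpn))
    exact ⟨t, Int.natAbs_dvd.1 ht⟩
  intro n
  induction n using Nat.recOnMul with
  | zero => intro h0; simp at h0
  | one => exact fun _ _ => ⟨0, by simp⟩
  | prime p hp => exact fun _ h => h p hp dvd_rfl
  | mul m k ihm ihk =>
    intro hmk h
    have hco : IsCoprime (m : ℤ) k :=
      Nat.isCoprime_iff_coprime.2 (Nat.coprime_of_squarefree_mul hmk)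
    obtain ⟨t, ht⟩ := ihm (hmk.squarefree_of_dvd (dvd_mul_right _ _))
      (fun p hp hd => h p hp (hd.mul_right _))
    obtain ⟨s, hs⟩ := ihk (hmk.squarefree_of_dvd (dvd_mul_left _ _))
      (fun p hp hd => h p hp (hd.mul_left _))
    obtain ⟨u, v, huv⟩ := id hco
    refine ⟨s * (u * m) + t * (v * k), ?_⟩
    rw [Nat.cast_mul]
    apply hco.mul_dvd
    · have h1 : s * (u * m) + t * (v * k) - t = m * (u * (s - t)) := by
        linear_combination t * huv
      have : (s * (u * m) + t * (v * k)) ^ 2 - a =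
          (s * (u * m) + t * (v * k) - t) * (s * (u * m) + t * (v * k) + t) + (t ^ 2 - a) := by
        ring
      rw [this, h1]
      exact dvd_add ((Dvd.intro _ rfl).mul_right _) ht
    · have h1 : s * (u * m) + t * (v * k) - s = k * (v * (t - s)) := by
        linear_combination s * huv
      have : (s * (u * m) + t * (v * k)) ^ 2 - a =
          (s * (u * m) + t * (v * k) - s) * (s * (u * m) + t * (v * k) + s) + (s ^ 2 - a) := by
        ring
      rw [this, h1]
      exact dvd_add ((Dvd.intro _ rfl).mul_right _) hs

theorem Int.exists_small_dvd_sq_sub {a b : ℤ} (hb : b ≠ 0) (h : ∃ t : ℤ, b ∣ t ^ 2 - a) :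
    ∃ t : ℤ, b ∣ t ^ 2 - a ∧ 2 * |t| ≤ |b| := by
  obtain ⟨t, ht⟩ := h
  have hpos : 0 < |b| := abs_pos.2 hb
  have key : ∀ r k : ℤ, t = r + b * k → b ∣ r ^ 2 - a := fun r k hr => by
    have : r ^ 2 - a = (t ^ 2 - a) - b * (k * (2 * r + b * k)) := by rw [hr]; ring
    rw [this]
    exact dvd_sub ht (Dvd.intro _ rfl)
  have h0 := Int.emod_nonneg t hb
  have h1 := Int.emod_lt_abs t hb
  have h2 := (Int.emod_add_mul_ediv t b).symm
  by_cases hc : 2 * (t % b) ≤ |b|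
  · exact ⟨t % b, key _ _ h2, by rwa [abs_of_nonneg h0]⟩
  · refine ⟨t % b - |b|, ?_, by rw [abs_of_nonpos (by linarith)]; linarith⟩
    rcases abs_choice b with hb' | hb'
    · exact key _ (t / b + 1) (by rw [hb']; linear_combination h2)
    · exact key _ (t / b - 1) (by rw [hb']; linear_combination h2)

theorem Padic.norm_mul_sq_ne_one_of_squarefree {p : ℕ} [hp : Fact p.Prime] {b : ℤ}
    (hb : Squarefree b) (hpb : (p : ℤ) ∣ b) (Y : ℚ_[p]) : ‖(b : ℚ_[p]) * Y ^ 2‖ ≠ 1 := by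
  intro heq
  have hbn : ‖(b : ℚ_[p])‖ < 1 := Padic.norm_intCast_lt_one_iff.2 hpb
  have hbY : ‖(b : ℚ_[p])‖ = ‖Y⁻¹‖ ^ 2 := by
    rw [norm_mul, norm_pow] at heq
    rw [norm_inv, inv_pow]
    exact eq_inv_of_mul_eq_one_left heq
  have hlt : ‖Y⁻¹‖ < 1 := by
    rw [hbY] at hbn
    nlinarith [norm_nonneg Y⁻¹]
  have hle : ‖Y⁻¹‖ ≤ (p : ℝ) ^ (-1 : ℤ) := by
    rw [Padic.norm_le_pow_iff_norm_lt_pow_add_one]; simpa using hlt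
  have h2 : ‖(b : ℚ_[p])‖ ≤ (p : ℝ) ^ (-(2 : ℕ) : ℤ) := by
    rw [hbY]
    calc ‖Y⁻¹‖ ^ 2 ≤ ((p : ℝ) ^ (-1 : ℤ)) ^ 2 := pow_le_pow_left₀ (norm_nonneg _) hle 2
      _ = (p : ℝ) ^ (-(2 : ℕ) : ℤ) := by
        rw [← zpow_natCast, ← zpow_mul]; norm_num
  have hdd := (Padic.norm_int_le_pow_iff_dvd b 2).1 h2
  have := hb (p : ℤ) (by rw [← sq]; exact_mod_cast hdd)
  exact hp.out.not_isUnit (Int.ofNat_isUnit.1 this)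

theorem HasConicPoint.isSquare_zmod {p : ℕ} [hp : Fact p.Prime] (hp2 : p ≠ 2) {a b : ℤ}
    (hb : Squarefree b) (hpb : (p : ℤ) ∣ b) (h : HasConicPoint (a : ℚ_[p]) (b : ℚ_[p])) :
    IsSquare (a : ZMod p) := by
  by_cases hpa : (p : ℤ) ∣ a
  · rw [(ZMod.intCast_zmod_eq_zero_iff_dvd a p).2 hpa]
    exact IsSquare.zero
  have hbsq : ¬IsSquare (b : ℚ_[p]) := fun hs =>
    Padic.not_dvd_of_isSquare_of_squarefree hb hs hpb
  have ha0 : (a : ℚ_[p]) ≠ 0 := by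
    rw [Int.cast_ne_zero]; rintro rfl; exact hpa (dvd_zero _)
  have hb0 : (b : ℚ_[p]) ≠ 0 := Int.cast_ne_zero.2 hb.ne_zero
  have han : ‖(a : ℚ_[p])‖ = 1 := by
    by_contra h1
    exact hpa (Padic.norm_intCast_lt_one_iff.1 (lt_of_le_of_ne (Padic.norm_int_le_one a) h1))
  obtain ⟨x, y, z, hne, h⟩ := h
  by_cases hx : x = 0
  · subst hx
    have hy : y ≠ 0 := by
      rintro rfl
      exact hne ⟨rfl, rfl, by simpa using h.symm⟩
    refine absurd ((Padic.isSquare_mul_sq_iff hy).1 ⟨z, ?_⟩) hbsq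
    linear_combination h
  set Y := y / x with hY
  have hZ : (a : ℚ_[p]) + b * Y ^ 2 = (z / x) ^ 2 := by
    rw [hY]; field_simp; linear_combination h
  rcases lt_trichotomy ‖(b : ℚ_[p]) * Y ^ 2‖ 1 with hlt | heq | hgt
  · apply Padic.isSquare_zmod_of_isSquare
    obtain ⟨s, hs⟩ := Padic.isSquare_of_norm_sub_one_lt_one hp2
      (y := ((a : ℚ_[p]) + b * Y ^ 2) / a) (by
        have : ((a : ℚ_[p]) + b * Y ^ 2) / a - 1 = b * Y ^ 2 / a := by field_simp; ring
        rwa [this, norm_div, han, div_one])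
    have hs0 : s ≠ 0 := by
      rintro rfl
      rw [mul_zero, div_eq_zero_iff, or_iff_left ha0] at hs
      have : ‖(a : ℚ_[p])‖ = ‖(b : ℚ_[p]) * Y ^ 2‖ := by
        rw [eq_neg_of_add_eq_zero_left hs, norm_neg]
      linarith
    refine (Padic.isSquare_mul_sq_iff hs0).1 ⟨z / x, ?_⟩
    rw [div_eq_iff ha0] at hs
    linear_combination -hs + hZ
  · exact absurd heq (Padic.norm_mul_sq_ne_one_of_squarefree hb hpb Y)
  · exfalso
    have hY0 : Y ≠ 0 := by
      rintro h0; simp [h0] at hgt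
      linarith
    have hbY0 : (b : ℚ_[p]) * Y ^ 2 ≠ 0 := mul_ne_zero hb0 (pow_ne_zero 2 hY0)
    obtain ⟨s, hs⟩ := Padic.isSquare_of_norm_sub_one_lt_one hp2
      (y := ((a : ℚ_[p]) + b * Y ^ 2) / (b * Y ^ 2)) (by
        have : ((a : ℚ_[p]) + b * Y ^ 2) / (b * Y ^ 2) - 1 = a / (b * Y ^ 2) := by
          field_simp; ring
        rw [this, norm_div, han, div_lt_one (by linarith)]
        exact hgt)
    have hs0 : s ≠ 0 := by
      rintro rfl
      rw [mul_zero, div_eq_zero_iff, or_iff_left hbY0] at hs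
      have : ‖(a : ℚ_[p])‖ = ‖(b : ℚ_[p]) * Y ^ 2‖ := by
        rw [eq_neg_of_add_eq_zero_left hs, norm_neg]
      linarith
    refine hbsq ((Padic.isSquare_mul_sq_iff (mul_ne_zero hY0 hs0)).1 ⟨z / x, ?_⟩)
    rw [div_eq_iff hbY0] at hs
    linear_combination -hs + hZ

/-- The Hasse principle for conics over `ℚ`, with the condition at `2` omitted thanks to the
product formula. -/
theorem HasConicPoint.int_of_padic {a b : ℤ} (ha : Squarefree a) (hb : Squarefree b)
    (hpos : ¬(a < 0 ∧ b < 0))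
    (h : ∀ (l : ℕ) [Fact l.Prime], l ≠ 2 → HasConicPoint (a : ℚ_[l]) (b : ℚ_[l])) :
    HasConicPoint (a : ℚ) (b : ℚ) := by
  induction hN : a.natAbs + b.natAbs using Nat.strong_induction_on generalizing a b with
  | _ N ih =>
  wlog hle : |a| ≤ |b| generalizing a b
  · exact (this hb ha (by tauto) (fun l _ hl => (h l hl).symm) (by omega) (le_of_not_ge hle)).symm
  have hb0 := hb.ne_zero
  have ha0 := ha.ne_zero
  by_cases hb1 : |b| = 1
  · have ha1 : |a| = 1 := by
      have := abs_pos.2 ha0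
      omega
    rcases (abs_eq zero_le_one).1 hb1 with rfl | rfl
    · exact .of_isSquare_right (by simp)
    rcases (abs_eq zero_le_one).1 ha1 with rfl | rfl
    · exact .of_isSquare_left (by simp)
    · exact absurd (by norm_num) hpos
  have hb2 : 2 ≤ |b| := by
    have := abs_pos.2 hb0
    omega
  obtain ⟨t, ⟨c, hc⟩, htb⟩ := Int.exists_small_dvd_sq_sub hb0 (Int.exists_dvd_sq_sub (a := a) hb (by
    intro p hp hpb
    have : Fact p.Prime := ⟨hp⟩
    have hsq : IsSquare (a : ZMod p) := by
      by_cases hp2 : p = 2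
      · subst hp2
        exact ZMod.isSquare_two _
      · exact (h p hp2).isSquare_zmod hp2 hb hpb
    obtain ⟨r, hr⟩ := hsq
    obtain ⟨t, rfl⟩ := ZMod.intCast_surjective r
    refine ⟨t, ?_⟩
    rw [← ZMod.intCast_zmod_eq_zero_iff_dvd]
    push_cast
    rw [hr]; ring))
  by_cases hc0 : c = 0
  · refine .of_isSquare_left ⟨t, ?_⟩
    subst hc0
    exact_mod_cast (by linear_combination -hc : a = t * t)
  have hclt : |c| < |b| := by
    have h1 : |b| * |c| ≤ |t| ^ 2 + |a| := by
      rw [← abs_mul, ← hc]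
      have := abs_sub (t ^ 2) a
      rwa [abs_pow] at this
    have h2 : 4 * |t| ^ 2 ≤ |b| ^ 2 := by nlinarith [abs_nonneg t]
    nlinarith
  obtain ⟨c', s, hc', hs, rfl⟩ := Int.exists_sq_mul_squarefree hc0
  have hcle : |c'| ≤ |c' * s ^ 2| := by
    rw [abs_mul]
    have : 1 ≤ |s ^ 2| := Int.one_le_abs (pow_ne_zero 2 hs)
    nlinarith [abs_nonneg c']
  have cast : ∀ {K : Type} [Field K] [CharZero K],
      HasConicPoint (a : K) (b : K) ↔ HasConicPoint (a : K) (c' : K) := by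
    intro K _ _
    have hs' : (s : K) ≠ 0 := Int.cast_ne_zero.2 hs
    have hc2 : ((c' : K) * (s : K) ^ 2) ≠ 0 := by exact_mod_cast hc0
    have hb' : (b : K) ≠ 0 := Int.cast_ne_zero.2 hb0
    have hcK : (b : K) * (c' * s ^ 2) = t ^ 2 - a := by exact_mod_cast hc.symm
    rw [← HasConicPoint.mul_sq_right_iff (b := (c' : K)) hs']
    exact ⟨of_mul_eq_sq_sub hb' hcK, of_mul_eq_sq_sub hc2 (by rw [mul_comm]; exact hcK)⟩
  refine cast.2 (ih (a.natAbs + c'.natAbs) ?_ ha hc' ?_ (fun l _ hl => cast.1 (h l hl)) rfl)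
  · have := hcle.trans_lt hclt
    rw [Int.abs_eq_natAbs, Int.abs_eq_natAbs] at this
    omega
  · rintro ⟨han, hcn⟩
    have hbp : 0 < b := by
      rcases lt_or_gt_of_ne hb0 with h' | h'
      · exact absurd ⟨han, h'⟩ hpos
      · exact h'
    have : c' * s ^ 2 < 0 := mul_neg_of_neg_of_pos hcn (by positivity)
    nlinarith [sq_nonneg t]

theorem HasConicPoint.rat_of_padic {a b : ℚ} (ha : a ≠ 0) (hb : b ≠ 0) (hpos : ¬(a < 0 ∧ b < 0))
    (h : ∀ (l : ℕ) [Fact l.Prime], l ≠ 2 → HasConicPoint (a : ℚ_[l]) (b : ℚ_[l])) :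
    HasConicPoint a b := by
  obtain ⟨m, s, hm, hs, rfl⟩ := Rat.exists_squarefree_mul_sq ha
  obtain ⟨n, r, hn, hr, rfl⟩ := Rat.exists_squarefree_mul_sq hb
  rw [mul_sq_left_iff hs, mul_sq_right_iff hr]
  refine int_of_padic hm hn ?_ fun l _ hl => ?_
  · rintro ⟨hm', hn'⟩
    exact hpos ⟨mul_neg_of_neg_of_pos (by exact_mod_cast hm') (by positivity),
      mul_neg_of_neg_of_pos (by exact_mod_cast hn') (by positivity)⟩
  · have := h l hl
    push_cast at this
    rwa [mul_sq_left_iff (by exact_mod_cast hs), mul_sq_right_iff (by exact_mod_cast hr)] at this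

theorem HasConicPoint.rat_of_int {a b : ℤ} (ha : a ≠ 0) (hb : b ≠ 0) (hpos : ¬(a < 0 ∧ b < 0))
    (h : ∀ (l : ℕ) [Fact l.Prime], l ≠ 2 → (¬(l : ℤ) ∣ a ∧ ¬(l : ℤ) ∣ b) ∨
      IsSquare (a : ℚ_[l]) ∨ IsSquare (b : ℚ_[l])) :
    HasConicPoint (a : ℚ) (b : ℚ) := by
  refine rat_of_padic (by exact_mod_cast ha) (by exact_mod_cast hb) (by exact_mod_cast hpos)
    fun l _ hl => ?_
  have norm_one : ∀ n : ℤ, ¬(l : ℤ) ∣ n → ‖(n : ℚ_[l])‖ = 1 := fun n hn => by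
    by_contra h1
    exact hn (Padic.norm_intCast_lt_one_iff.1 (lt_of_le_of_ne (Padic.norm_int_le_one n) h1))
  push_cast
  rcases h l hl with h | h | h
  · exact Padic.hasConicPoint_of_norm_eq_one hl (norm_one a h.1) (norm_one b h.2)
  · exact .of_isSquare_left h
  · exact .of_isSquare_right h

theorem Padic.hasConicPoint_of_norm_lt {p : ℕ} [Fact p.Prime] (hp2 : p ≠ 2)
    {e b K α β σ δ : ℚ_[p]} (h : α ^ 2 - b * β ^ 2 = K + e * (σ ^ 2 - b * δ ^ 2))
    (hK : ‖K‖ < ‖e * σ ^ 2‖) : HasConicPoint e b := by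
  by_cases hb : IsSquare b
  · exact .of_isSquare_right hb
  have hpos : 0 < ‖e * σ ^ 2‖ := (norm_nonneg _).trans_lt hK
  have he : e ≠ 0 := by rintro rfl; simp at hpos
  have hσ : σ ≠ 0 := by rintro rfl; simp at hpos
  set ν := σ ^ 2 - b * δ ^ 2 with hν
  have hle : ‖σ ^ 2‖ ≤ ‖ν‖ := by
    by_contra! hlt
    obtain ⟨w, hw⟩ := isSquare_of_norm_sub_one_lt_one hp2 (y := 1 - ν / σ ^ 2) (by
      have : 1 - ν / σ ^ 2 - 1 = -(ν / σ ^ 2) := by ring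
      rw [this, norm_neg, norm_div, div_lt_one (norm_pos_iff.2 (pow_ne_zero 2 hσ))]
      exact hlt)
    have hbδ : b * δ ^ 2 = (σ * w) * (σ * w) := by
      have : b * δ ^ 2 = σ ^ 2 * (1 - ν / σ ^ 2) := by field_simp; rw [hν]; ring
      rw [this, hw]; ring
    by_cases hδ : δ = 0
    · rw [hν, hδ] at hlt
      simp at hlt
    · exact hb ((isSquare_mul_sq_iff hδ).1 ⟨_, hbδ⟩)
  have hν0 : ν ≠ 0 := by
    intro h0
    rw [h0, norm_zero] at hle
    exact (norm_pos_iff.2 (pow_ne_zero 2 hσ)).not_ge hle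
  have heν : e * ν ≠ 0 := mul_ne_zero he hν0
  have hlt : ‖K / (e * ν)‖ < 1 := by
    rw [norm_div, div_lt_one (norm_pos_iff.2 heν)]
    refine hK.trans_le ?_
    rw [norm_mul, norm_mul]
    exact mul_le_mul_of_nonneg_left hle (norm_nonneg _)
  obtain ⟨y, hy⟩ := isSquare_of_norm_sub_one_lt_one hp2 (y := 1 + K / (e * ν)) (by
    rwa [add_sub_cancel_left])
  have hy0 : y ≠ 0 := by
    rintro rfl
    rw [mul_zero] at hy
    rw [eq_neg_of_add_eq_zero_right hy] at hlt
    simp at hlt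
  refine ⟨ν * y, α * δ + β * σ, α * σ + b * β * δ,
    fun h0 => mul_ne_zero hν0 hy0 h0.1, ?_⟩
  have h1 : α ^ 2 - b * β ^ 2 = e * ν * (y * y) := by
    rw [h, ← hy]; field_simp; ring
  have h2 : (α ^ 2 - b * β ^ 2) * ν = (α * σ + b * β * δ) ^ 2 - b * (α * δ + β * σ) ^ 2 := by
    rw [hν]; ring
  linear_combination h2 - ν * h1

theorem Int.eq_zero_of_conic {E q : ℤ} (hE : E % 8 = 5) (hq : q % 2 = 1) {x y z : ℤ}
    (h : E * x ^ 2 + 2 * q * y ^ 2 = z ^ 2) : x = 0 ∧ y = 0 ∧ z = 0 := by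
  induction hN : x.natAbs + y.natAbs + z.natAbs using Nat.strong_induction_on
    generalizing x y z with
  | _ N ih =>
  by_cases h0 : x = 0 ∧ y = 0 ∧ z = 0
  · exact h0
  obtain ⟨E', rfl⟩ : ∃ k, E = 8 * k + 5 := ⟨E / 8, by omega⟩
  obtain ⟨q', rfl⟩ : ∃ k, q = 2 * k + 1 := ⟨q / 2, by omega⟩
  have key : (2 : ℤ) ∣ x ∧ (2 : ℤ) ∣ y ∧ (2 : ℤ) ∣ z := by
    have sq_mod : ∀ n : ℤ, (∃ k, n = 2 * k ∧ n ^ 2 = 4 * k ^ 2) ∨ ∃ k, n ^ 2 = 8 * k + 1 := by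
      intro n
      rcases Int.even_or_odd n with ⟨k, hk⟩ | hn
      · exact .inl ⟨k, by omega, by rw [hk]; ring⟩
      · exact .inr ⟨n ^ 2 / 8, by have := Int.eight_dvd_sq_sub_one_of_odd hn; omega⟩
    rcases sq_mod x with ⟨a, ha, hx⟩ | ⟨a, hx⟩ <;> rcases sq_mod y with ⟨b, hb, hy⟩ | ⟨b, hy⟩ <;>
      rcases sq_mod z with ⟨c, hc, hz⟩ | ⟨c, hz⟩
    · exact ⟨⟨a, ha⟩, ⟨b, hb⟩, ⟨c, hc⟩⟩
    all_goals
      exfalso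
      rw [hx, hy, hz] at h
      ring_nf at h
      omega
  obtain ⟨⟨a, rfl⟩, ⟨b, rfl⟩, ⟨c, rfl⟩⟩ := key
  have := ih (a.natAbs + b.natAbs + c.natAbs) (by omega) (x := a) (y := b) (z := c)
    (by linarith) rfl
  omega

theorem not_hasConicPoint_rat {E q : ℤ} (hE : E % 8 = 5) (hq : q % 2 = 1) :
    ¬HasConicPoint (E : ℚ) (2 * q : ℚ) := by
  rintro ⟨x, y, z, hne, h⟩
  have hx : (x.den : ℚ) ≠ 0 := by exact_mod_cast x.den_ne_zero
  have hy : (y.den : ℚ) ≠ 0 := by exact_mod_cast y.den_ne_zero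
  have hz : (z.den : ℚ) ≠ 0 := by exact_mod_cast z.den_ne_zero
  have h' : E * (x.num * y.den * z.den) ^ 2 + 2 * q * (y.num * x.den * z.den) ^ 2 =
      (z.num * x.den * y.den) ^ 2 := by
    have : (E : ℚ) * (x.num * y.den * z.den) ^ 2 + 2 * q * (y.num * x.den * z.den) ^ 2 =
        (z.num * x.den * y.den) ^ 2 := by
      rw [← Rat.num_div_den x, ← Rat.num_div_den y, ← Rat.num_div_den z] at h
      field_simp at h
      linear_combination h
    exact_mod_cast this
  have := Int.eq_zero_of_conic hE hq h'
  simp at this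
  tauto

theorem Padic.le_norm_of_dvd_den {p : ℕ} [hp : Fact p.Prime] {t : ℚ} (h : p ∣ t.den) :
    (p : ℝ) ≤ ‖(t : ℚ_[p])‖ := by
  have hnum : ‖(t.num : ℚ_[p])‖ = 1 :=
    Padic.norm_intCast_eq_one_iff.2 (Int.isCoprime_iff_gcd_eq_one.2
      (t.reduced.coprime_dvd_right h))
  have hden : ‖(t.den : ℚ_[p])‖ ≤ (p : ℝ)⁻¹ := by
    have := (Padic.norm_int_le_pow_iff_dvd (p := p) t.den 1).2
      (by simpa using Int.natCast_dvd_natCast.2 h)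
    simpa using this
  have hd0 : 0 < ‖(t.den : ℚ_[p])‖ := norm_pos_iff.2 (by exact_mod_cast t.den_ne_zero)
  have ht : (t : ℚ_[p]) = t.num / t.den := by
    exact_mod_cast congrArg (fun x : ℚ => (x : ℚ_[p])) (Rat.num_div_den t).symm
  rw [ht, norm_div, hnum, le_div_iff₀ hd0]
  have hp0 : (0 : ℝ) < p := by exact_mod_cast hp.out.pos
  calc (p : ℝ) * ‖(t.den : ℚ_[p])‖ ≤ p * (p : ℝ)⁻¹ := by gcongr
    _ = 1 := mul_inv_cancel₀ hp0.ne'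

theorem hasConicPoint_padic_of_dvd_den {q : ℕ} (hq : q.Prime) {t e f h α β α' β' δ' : ℚ}
    (ht : q ∣ t.den) (hf : e * f = 1) (hh : h ≠ 0)
    (hA : α ^ 2 - e * β ^ 2 = h ^ 2 * ((1 + q ^ 2) ^ 2 + 32 * q * t ^ 2))
    (hB : α' ^ 2 - 2 * q * β' ^ 2 + 2 * q * e * δ' ^ 2 =
      h ^ 2 * ((1 + q ^ 2) ^ 2 + 64 * q ^ 2 * (e ^ 2 + 1) ^ 2 * f))
    {l : ℕ} [Fact l.Prime] (hl : l ≠ 2) :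
    HasConicPoint (e : ℚ_[l]) (2 * q : ℚ_[l]) := by
  have he0 : (e : ℚ_[l]) ≠ 0 := by exact_mod_cast left_ne_zero_of_mul_eq_one hf
  have hhn : 0 < ‖(h : ℚ_[l])‖ := norm_pos_iff.2 (by exact_mod_cast hh)
  have hf' : (f : ℚ_[l]) = (e : ℚ_[l])⁻¹ :=
    eq_inv_of_mul_eq_one_right (by exact_mod_cast congrArg (fun x : ℚ => (x : ℚ_[l])) hf)
  have hl2 : ‖(2 : ℚ_[l])‖ = 1 := Padic.norm_two_of_ne hl
  have hA' := congrArg (fun x : ℚ => (x : ℚ_[l])) hA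
  have hB' := congrArg (fun x : ℚ => (x : ℚ_[l])) hB
  push_cast at hA' hB'
  have hK : ‖(h : ℚ_[l]) ^ 2 * (1 + (q : ℚ_[l]) ^ 2) ^ 2‖ ≤ ‖(h : ℚ_[l])‖ ^ 2 := by
    rw [norm_mul, norm_pow, norm_pow]
    have h1 := Padic.norm_int_le_one (p := l) (1 + q ^ 2)
    push_cast at h1
    exact mul_le_of_le_one_right (by positivity) (pow_le_one₀ (norm_nonneg _) h1)
  by_cases hlq : l = q
  · subst hlq
    refine .symm (Padic.hasConicPoint_of_norm_lt hl (α := α) (β := β) (σ := 4 * h * t) (δ := 0)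
      (K := h ^ 2 * (1 + (l : ℚ_[l]) ^ 2) ^ 2) (by rw [hA']; ring) (hK.trans_lt ?_))
    have h1 : (2 * (l : ℚ_[l])) * (4 * h * t) ^ 2 = 2 ^ 5 * (l * h ^ 2 * t ^ 2) := by ring
    have hl1 : (1 : ℝ) < l := by exact_mod_cast hq.one_lt
    have htn := Padic.le_norm_of_dvd_den ht
    rw [h1, norm_mul, norm_pow, hl2, norm_mul, norm_mul, Padic.norm_p, norm_pow, norm_pow]
    have h2 : 1 < (l : ℝ)⁻¹ * ‖(t : ℚ_[l])‖ ^ 2 := by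
      rw [inv_mul_eq_div, one_lt_div (by linarith)]
      nlinarith
    have h3 := mul_lt_mul_of_pos_left h2 (pow_pos hhn 2)
    linarith
  have hqn : ‖(q : ℚ_[l])‖ = 1 :=
    Padic.norm_natCast_eq_one_iff.2 ((Nat.coprime_primes Fact.out hq).2 hlq)
  by_cases hen : ‖(e : ℚ_[l])‖ = 1
  · exact Padic.hasConicPoint_of_norm_eq_one hl hen (by rw [norm_mul, hl2, hqn, one_mul])
  have hepos : 0 < ‖(e : ℚ_[l])‖ := norm_pos_iff.2 he0
  refine Padic.hasConicPoint_of_norm_lt hl (α := α') (β := β') (σ := 8 * q * h * (e ^ 2 + 1) / e)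
    (δ := δ') (K := h ^ 2 * (1 + (q : ℚ_[l]) ^ 2) ^ 2) ?_ (hK.trans_lt ?_)
  · rw [hf'] at hB'
    field_simp at hB' ⊢
    linear_combination hB'
  · have h1 : (e : ℚ_[l]) * (8 * q * h * (e ^ 2 + 1) / e) ^ 2 =
        2 ^ 6 * (q ^ 2 * (h ^ 2 * ((e ^ 2 + 1) ^ 2 / e))) := by
      field_simp; ring
    rw [h1, norm_mul, norm_pow, hl2, norm_mul, norm_pow, hqn, norm_mul, norm_pow, norm_div,
      norm_pow]
    suffices 1 < ‖(e : ℚ_[l]) ^ 2 + 1‖ ^ 2 / ‖(e : ℚ_[l])‖ by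
      have h3 := mul_lt_mul_of_pos_left this (pow_pos hhn 2)
      linarith
    rw [one_lt_div hepos]
    have hne : ‖(e : ℚ_[l]) ^ 2‖ ≠ ‖(1 : ℚ_[l])‖ := by
      rw [norm_pow, norm_one]
      exact fun h => hen ((pow_eq_one_iff_of_nonneg hepos.le two_ne_zero).1 h)
    rw [Padic.add_eq_max_of_ne hne, norm_pow, norm_one]
    rcases lt_or_gt_of_ne hen with h2 | h2
    · have := le_max_right (‖(e : ℚ_[l])‖ ^ 2) 1
      nlinarith
    · have := le_max_left (‖(e : ℚ_[l])‖ ^ 2) 1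
      have h3 : ‖(e : ℚ_[l])‖ < ‖(e : ℚ_[l])‖ ^ 2 := by nlinarith
      nlinarith

theorem false_of_dvd_den {q : ℕ} (hq : q.Prime) (hq2 : q ≠ 2) {t w f h α β α' β' δ' : ℚ}
    (ht : q ∣ t.den) (hw : ¬2 ∣ w.den) (hf : (5 + 8 * w) * f = 1) (hh : h ≠ 0)
    (hA : α ^ 2 - (5 + 8 * w) * β ^ 2 = h ^ 2 * ((1 + q ^ 2) ^ 2 + 32 * q * t ^ 2))
    (hB : α' ^ 2 - 2 * q * β' ^ 2 + 2 * q * (5 + 8 * w) * δ' ^ 2 =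
      h ^ 2 * ((1 + q ^ 2) ^ 2 + 64 * q ^ 2 * ((5 + 8 * w) ^ 2 + 1) ^ 2 * f)) : False := by
  have hqpos : (0 : ℚ) < q := by exact_mod_cast hq.pos
  have hd : (w.den : ℚ) ≠ 0 := by exact_mod_cast w.den_ne_zero
  have hconic : HasConicPoint (5 + 8 * w) (2 * q : ℚ) := by
    refine .rat_of_padic (left_ne_zero_of_mul_eq_one hf) (by positivity)
      (fun h => by linarith [h.2]) fun l _ hl => ?_
    have := hasConicPoint_padic_of_dvd_den hq ht hf hh hA hB hl
    exact_mod_cast this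
  rw [← HasConicPoint.mul_sq_left_iff hd] at hconic
  have hE : (5 + 8 * w) * (w.den : ℚ) ^ 2 = ((w.den * (5 * w.den + 8 * w.num) : ℤ) : ℚ) := by
    push_cast
    nth_rewrite 1 [← Rat.num_div_den w]
    field_simp
  rw [hE] at hconic
  refine not_hasConicPoint_rat (q := q) ?_ ?_ (by exact_mod_cast hconic)
  · have := Int.eight_dvd_sq_sub_one_of_odd (k := w.den) (by
      rw [Int.odd_coe_nat]; exact Nat.odd_iff.2 (by omega))
    have h2 : (w.den : ℤ) * (5 * w.den + 8 * w.num) = 5 * w.den ^ 2 + 8 * (w.den * w.num) := by ring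
    push_cast
    rw [h2]
    omega
  · have := hq.eq_two_or_odd.resolve_left hq2
    omega

section

open scoped NumberTheorySymbols

theorem jacobiSym.eq_one_of_forall_isSquare {a : ℤ} {c : ℕ}
    (h : ∀ l : ℕ, l.Prime → l ∣ c → IsSquare (a : ZMod l) ∧ ¬(l : ℤ) ∣ a) : J(a | c) = 1 := by
  rw [jacobiSym]
  refine List.prod_eq_one fun x hx => ?_
  obtain ⟨l, hl, rfl⟩ := List.mem_pmap.1 hx
  have hlp := Nat.prime_of_mem_primeFactorsList hl
  have : Fact l.Prime := ⟨hlp⟩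
  obtain ⟨hsq, hd⟩ := h l hlp (Nat.dvd_of_mem_primeFactorsList hl)
  exact (legendreSym.eq_one_iff l (by rwa [Ne, ZMod.intCast_zmod_eq_zero_iff_dvd])).2 hsq

theorem jacobiSym.sign_mul_two_pow_mul {ε : ℤ} (hε : ε = 1 ∨ ε = -1) (k : ℕ) {c N : ℕ}
    (hc : Odd c) (hN : N % 4 = 1) : J(ε * 2 ^ k * c | N) = J(2 | N) ^ k * J(N | c) := by
  have hN' : Odd N := Nat.odd_iff.2 (by omega)
  have h1 : J(ε | N) = 1 := by
    rcases hε with rfl | rfl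
    · exact jacobiSym.one_left N
    · rw [jacobiSym.at_neg_one hN', ZMod.χ₄_nat_one_mod_four hN]
  rw [jacobiSym.mul_left, jacobiSym.mul_left, h1, jacobiSym.pow_left, one_mul,
    jacobiSym.quadratic_reciprocity_one_mod_four' hc hN]

theorem jacobiSym.two_of_mod_eight_eq_one {N : ℕ} (hN : N % 8 = 1) : J(2 | N) = 1 := by
  rw [jacobiSym.at_two (Nat.odd_iff.2 (by omega)), ZMod.χ₈_nat_eq_if_mod_eight]
  simp [hN]; omega

theorem jacobiSym.two_of_mod_eight_eq_five {N : ℕ} (hN : N % 8 = 5) : J(2 | N) = -1 := by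
  rw [jacobiSym.at_two (Nat.odd_iff.2 (by omega)), ZMod.χ₈_nat_eq_if_mod_eight]
  simp [hN]; omega

theorem Padic.isSquare_intCast_of_jacobiSym {p : ℕ} [Fact p.Prime] (hp2 : p ≠ 2) {a : ℤ}
    (h : J(a | p) = 1) : IsSquare (a : ℚ_[p]) := by
  refine Padic.isSquare_intCast hp2 (fun hd => ?_) (ZMod.isSquare_of_jacobiSym_eq_one h)
  rw [jacobiSym.mod_left, Int.emod_eq_zero_of_dvd hd,
    jacobiSym.zero_left (Fact.out : p.Prime).one_lt] at h
  exact zero_ne_one h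

theorem Int.exists_sub_dvd_of_isCoprime {m k : ℤ} (h : IsCoprime m k) (s t : ℤ) :
    ∃ a : ℤ, m ∣ a - s ∧ k ∣ a - t := by
  obtain ⟨u, v, huv⟩ := h
  exact ⟨t * (u * m) + s * (v * k), ⟨u * (t - s), by linear_combination s * huv⟩,
    ⟨v * (s - t), by linear_combination t * huv⟩⟩

theorem Int.isCoprime_of_dvd_sub {m a s : ℤ} (h : m ∣ a - s) (hs : IsCoprime s m) :
    IsCoprime a m := by
  obtain ⟨c, hc⟩ := h
  have : a = s + m * c := by linear_combination hc
  rw [this]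
  exact hs.add_mul_left_left c

theorem Nat.exists_prime_gt_of_isCoprime {m k : ℕ} (hm : m ≠ 0) (hk : k ≠ 0)
    (h : IsCoprime (m : ℤ) k) {s t : ℤ} (hs : IsCoprime s m) (ht : IsCoprime t k) (B : ℕ) :
    ∃ p > B, p.Prime ∧ (m : ℤ) ∣ p - s ∧ (k : ℤ) ∣ p - t := by
  obtain ⟨a, ham, hak⟩ := Int.exists_sub_dvd_of_isCoprime h s t
  obtain ⟨p, hpB, hp, hpa⟩ := Nat.forall_exists_prime_gt_and_zmodEq B (q := m * k) (a := a)
    (mul_ne_zero hm hk) (by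
      push_cast
      exact (Int.isCoprime_of_dvd_sub ham hs).mul_right (Int.isCoprime_of_dvd_sub hak ht))
  have hd := hpa.symm.dvd
  push_cast at hd
  refine ⟨p, hpB, hp, ?_, ?_⟩
  · have := dvd_add ((dvd_mul_right (m : ℤ) k).trans hd) ham
    simpa using this
  · have := dvd_add ((dvd_mul_left (k : ℤ) m).trans hd) hak
    simpa using this

theorem jacobiSym.exists_eq {l : ℕ} (hl : l.Prime) (hl2 : l ≠ 2) {σ : ℤ} (hσ : σ = 1 ∨ σ = -1) :
    ∃ g : ℤ, J(g | l) = σ := by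
  have : Fact l.Prime := ⟨hl⟩
  rcases hσ with rfl | rfl
  · exact ⟨1, jacobiSym.one_left l⟩
  · obtain ⟨g, hg⟩ := quadraticChar_exists_neg_one (F := ZMod l) (by rwa [ZMod.ringChar_zmod_n])
    obtain ⟨g, rfl⟩ := ZMod.intCast_surjective g
    exact ⟨g, by rw [← jacobiSym.legendreSym.to_jacobiSym]; exact hg⟩

theorem Nat.exists_prime_mod_eight_eq_five {m l : ℕ} (hm : Odd m) (hl : l.Prime) (hl2 : l ≠ 2)
    (hlm : l.Coprime m) {σ : ℤ} (hσ : σ = 1 ∨ σ = -1) (B : ℕ) :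
    ∃ p > B, p.Prime ∧ p % 8 = 5 ∧ (m : ℤ) ∣ p - 1 ∧ J(p | l) = σ := by
  have : Fact l.Prime := ⟨hl⟩
  obtain ⟨g, hg⟩ := jacobiSym.exists_eq hl hl2 hσ
  have hgl : IsCoprime g l := by
    rw [Int.isCoprime_iff_gcd_eq_one]
    by_contra hgcd
    rw [jacobiSym.eq_zero_iff_not_coprime.2 hgcd] at hg
    rcases hσ with rfl | rfl <;> norm_num at hg
  have h8m : IsCoprime (8 : ℤ) m := by
    have : Nat.Coprime 8 m := (Nat.Coprime.pow_left 3 (Nat.coprime_two_left.2 hm) :)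
    exact_mod_cast Nat.isCoprime_iff_coprime.2 this
  have h8l : IsCoprime (8 : ℤ) l := by
    have : Nat.Coprime 8 l := (Nat.Coprime.pow_left 3
      ((Nat.coprime_primes Nat.prime_two hl).2 (Ne.symm hl2)) :)
    exact_mod_cast Nat.isCoprime_iff_coprime.2 this
  obtain ⟨a, ha8, ham⟩ := Int.exists_sub_dvd_of_isCoprime h8m 5 1
  obtain ⟨p, hpB, hp, hpa, hpg⟩ := Nat.exists_prime_gt_of_isCoprime (m := 8 * m) (k := l) (s := a)
    (t := g) (mul_ne_zero (by norm_num) hm.pos.ne') hl.ne_zero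
    (by push_cast; exact h8l.mul_left (Nat.isCoprime_iff_coprime.2 hlm.symm))
    (by
      push_cast
      refine (Int.isCoprime_of_dvd_sub ha8 ?_).mul_right
        (Int.isCoprime_of_dvd_sub ham isCoprime_one_left)
      exact ⟨-3, 2, by norm_num⟩) hgl B
  push_cast at hpa
  refine ⟨p, hpB, hp, ?_, ?_, ?_⟩
  · have := dvd_add ((dvd_mul_right 8 (m : ℤ)).trans hpa) ha8
    omega
  · have := dvd_add ((dvd_mul_left (m : ℤ) 8).trans hpa) ham
    simpa using this
  · rw [← hg]
    exact jacobiSym.mod_left'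
      (Int.emod_eq_emod_iff_emod_sub_eq_zero.2 (Int.emod_eq_zero_of_dvd hpg))

theorem Int.exists_eq_sign_mul_two_pow_mul {x : ℤ} (hx : Squarefree x)
    (h : x ≠ 1 ∧ x ≠ -1 ∧ x ≠ 2 ∧ x ≠ -2) :
    ∃ (ε : ℤ) (k l w : ℕ), (ε = 1 ∨ ε = -1) ∧ l.Prime ∧ l ≠ 2 ∧ Odd w ∧ l.Coprime w ∧
      x = ε * 2 ^ k * (l * w : ℕ) := by
  obtain ⟨k, c, hc, hxc⟩ := Nat.exists_eq_two_pow_mul_odd (n := x.natAbs)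
    (Int.natAbs_ne_zero.2 hx.ne_zero)
  have hsq : Squarefree (2 ^ k * c) := by rw [← hxc]; exact Int.squarefree_natAbs.2 hx
  have hc1 : c ≠ 1 := by
    rintro rfl
    have hk : k ≤ 1 := by
      by_contra! hk
      have := hsq 2 ((pow_dvd_pow 2 hk).mul_right 1)
      exact Nat.prime_two.not_isUnit this
    interval_cases k <;> simp at hxc <;> omega
  obtain ⟨w, hw⟩ := Nat.minFac_dvd c
  have hlp := Nat.minFac_prime hc1
  have hcop : c.minFac.Coprime w :=
    Nat.coprime_of_squarefree_mul (hw ▸ hsq.squarefree_of_dvd (dvd_mul_left _ _))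
  have hodd : Odd (c.minFac * w) := by rwa [← hw]
  rw [Nat.odd_mul] at hodd
  have habs : (x.natAbs : ℤ) = 2 ^ k * (c.minFac * w : ℕ) := by
    rw [← hw, hxc]; push_cast; ring
  rcases Int.natAbs_eq x with hx' | hx'
  · exact ⟨1, k, c.minFac, w, .inl rfl, hlp,
      fun h2 => by rw [h2] at hodd; exact absurd hodd.1 (by decide),
      hodd.2, hcop, by rw [hx', habs]; ring⟩
  · exact ⟨-1, k, c.minFac, w, .inr rfl, hlp,
      fun h2 => by rw [h2] at hodd; exact absurd hodd.1 (by decide),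
      hodd.2, hcop, by rw [hx', habs]; ring⟩

theorem HasConicPoint.exists_eq_sq_sub {F : Type*} [Field F] {a b : F} (ha : ¬IsSquare a)
    (h : HasConicPoint a b) : ∃ α β : F, b = α ^ 2 - a * β ^ 2 := by
  obtain ⟨x, y, z, hne, h⟩ := h
  by_cases hy : y = 0
  · subst hy
    by_cases hx : x = 0
    · subst hx
      exact absurd ⟨rfl, rfl, by simpa using h.symm⟩ hne
    · refine absurd ⟨z / x, ?_⟩ ha
      field_simp
      linear_combination h
  · refine ⟨z / y, x / y, ?_⟩
    field_simp
    linear_combination h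

namespace Padic

variable {l : ℕ} [Fact l.Prime]

theorem isSquare_sq_add_of_norm_lt {P c : ℚ_[l]} (h : ‖c‖ < ‖(2 : ℚ_[l])‖ ^ 2 * ‖P‖ ^ 2) :
    IsSquare (P ^ 2 + c) := by
  have hP : P ≠ 0 := by
    rintro rfl
    simp at h
    exact absurd h (norm_nonneg c).not_gt
  have hPn : 0 < ‖P‖ ^ 2 := pow_pos (norm_pos_iff.2 hP) 2
  have heq : P ^ 2 + c = (1 + c / P ^ 2) * P ^ 2 := by field_simp
  rw [heq, Padic.isSquare_mul_sq_iff hP]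
  refine Padic.isSquare_of_norm_sub_one_lt ?_
  rw [add_sub_cancel_left, norm_div, norm_pow, div_lt_iff₀ hPn]
  exact h

theorem norm_lt_norm_one_add_sq_sq {x : ℚ_[l]} (hx : ‖x‖ ≠ 1) :
    ‖x‖ < ‖1 + x ^ 2‖ ^ 2 ∧ ‖x ^ 2‖ < ‖1 + x ^ 2‖ ^ 2 := by
  have h0 := norm_nonneg x
  rcases lt_or_gt_of_ne hx with h | h
  · have h2 : ‖x‖ ^ 2 < 1 := pow_lt_one₀ h0 h two_ne_zero
    have : ‖1 + x ^ 2‖ = 1 := by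
      rw [Padic.add_eq_max_of_ne (by simp; exact h2.ne'), norm_one, norm_pow,
        max_eq_left h2.le]
    rw [this, norm_pow]
    exact ⟨by simpa using h, by simpa using h2⟩
  · have h2 : 1 < ‖x‖ ^ 2 := one_lt_pow₀ h two_ne_zero
    have : ‖1 + x ^ 2‖ = ‖x‖ ^ 2 := by
      rw [Padic.add_eq_max_of_ne (by simp; exact h2.ne), norm_one, norm_pow,
        max_eq_right h2.le]
    rw [this, norm_pow]
    exact ⟨by nlinarith, by nlinarith⟩

theorem half_le_norm_one_add_sq {x : ℚ_[2]} (hx : ‖x‖ ≤ 1) : 2⁻¹ ≤ ‖1 + x ^ 2‖ := by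
  let y : ℤ_[2] := ⟨x, hx⟩
  have hy : ‖1 + x ^ 2‖ = ‖1 + y ^ 2‖ := by
    rw [PadicInt.norm_def]; push_cast; rfl
  rw [hy]
  by_contra! hlt
  have h4 : ‖1 + y ^ 2‖ ≤ (2 : ℝ) ^ (-(2 : ℕ) : ℤ) := by
    have := (PadicInt.norm_le_pow_iff_norm_lt_pow_add_one (p := 2) (1 + y ^ 2) (-2)).2
      (by norm_num at hlt ⊢; exact hlt)
    exact_mod_cast this
  have hmem := (PadicInt.norm_le_pow_iff_mem_span_pow (p := 2) (1 + y ^ 2) 2).1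
    (by exact_mod_cast h4)
  rw [← PadicInt.ker_toZModPow, RingHom.mem_ker, map_add, map_one, map_pow] at hmem
  generalize PadicInt.toZModPow 2 y = z at hmem
  revert z
  decide

theorem isSquare_one_add_sq_sq_add {x a : ℚ_[l]} (ha : ‖a‖ ≤ 1)
    (h : l ≠ 2 ∧ ‖x‖ ≠ 1 ∨ l = 2 ∧ ‖x‖ ≤ 1) :
    IsSquare ((1 + x ^ 2) ^ 2 + 32 * x * a) ∧ IsSquare ((1 + x ^ 2) ^ 2 + 64 * x ^ 2 * a) := by
  rcases h with ⟨hl, hx⟩ | ⟨rfl, hx⟩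
  · obtain ⟨h1, h2⟩ := norm_lt_norm_one_add_sq_sq hx
    have h32 : ‖(32 : ℚ_[l])‖ = 1 := by
      rw [show (32 : ℚ_[l]) = 2 ^ 5 by norm_num, norm_pow, norm_two_of_ne hl, one_pow]
    have h64 : ‖(64 : ℚ_[l])‖ = 1 := by
      rw [show (64 : ℚ_[l]) = 2 ^ 6 by norm_num, norm_pow, norm_two_of_ne hl, one_pow]
    constructor <;> apply isSquare_sq_add_of_norm_lt <;>
      rw [norm_two_of_ne hl, one_pow, one_mul, norm_mul, norm_mul]
    · rw [h32, one_mul]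
      exact (mul_le_of_le_one_right (norm_nonneg _) ha).trans_lt h1
    · rw [h64, one_mul]
      exact (mul_le_of_le_one_right (norm_nonneg _) ha).trans_lt h2
  · have hP := half_le_norm_one_add_sq hx
    have hP2 : (2⁻¹ : ℝ) ^ 2 ≤ ‖1 + x ^ 2‖ ^ 2 := pow_le_pow_left₀ (by norm_num) hP 2
    have h2 : ‖(2 : ℚ_[2])‖ = 2⁻¹ := by simpa using Padic.norm_p (p := 2)
    have h32 : ‖(32 : ℚ_[2])‖ = 1 / 32 := by
      rw [show (32 : ℚ_[2]) = 2 ^ 5 by norm_num, norm_pow, h2]; norm_num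
    have h64 : ‖(64 : ℚ_[2])‖ = 1 / 64 := by
      rw [show (64 : ℚ_[2]) = 2 ^ 6 by norm_num, norm_pow, h2]; norm_num
    have hxa : ‖x‖ * ‖a‖ ≤ 1 := mul_le_one₀ hx (norm_nonneg _) ha
    have hxa2 : ‖x‖ ^ 2 * ‖a‖ ≤ 1 :=
      mul_le_one₀ (pow_le_one₀ (norm_nonneg _) hx) (norm_nonneg _) ha
    constructor <;> apply isSquare_sq_add_of_norm_lt <;> rw [h2, norm_mul, norm_mul]
    · rw [h32]; nlinarith
    · rw [h64, norm_pow]; nlinarith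

theorem norm_ratCast_eq_one {x : ℚ} (hn : ¬(l : ℤ) ∣ x.num) (hd : ¬l ∣ x.den) :
    ‖(x : ℚ_[l])‖ = 1 := by
  have h1 : ‖((x.num : ℤ) : ℚ_[l])‖ = 1 := Padic.norm_intCast_eq_one_iff.2
    ((Nat.prime_iff_prime_int.1 Fact.out).coprime_iff_not_dvd.2 hn).symm
  have h2 : ‖((x.den : ℤ) : ℚ_[l])‖ = 1 := Padic.norm_intCast_eq_one_iff.2
    ((Nat.prime_iff_prime_int.1 Fact.out).coprime_iff_not_dvd.2
      (by exact_mod_cast hd)).symm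
  rw [Rat.cast_def, norm_div, h1]
  simpa using h2

end Padic

theorem Rat.not_isSquare_intCast_of_dvd {a : ℤ} {p : ℕ} (hp : p.Prime) (hd : (p : ℤ) ∣ a)
    (hd2 : ¬(p : ℤ) ^ 2 ∣ a) : ¬IsSquare (a : ℚ) := by
  rw [Rat.isSquare_intCast_iff]
  rintro ⟨r, rfl⟩
  have hr : (p : ℤ) ∣ r := by
    rcases (Nat.prime_iff_prime_int.1 hp).dvd_or_dvd hd with h | h <;> exact h
  exact hd2 (by rw [sq]; exact mul_dvd_mul hr hr)

/-- Local-global solution of `m = α² - 2 x β² + 2 x p δ²`, obtained by splitting it into two conics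
with the help of an auxiliary prime. -/
theorem exists_eq_sq_sub_two_mul_of_local {D u : ℤ} {p m₁ : ℕ} [hpF : Fact p.Prime]
    (hp8 : p % 8 = 5) (hD : J(D | p) = 1) (hu : u = p * m₁) (husq : Squarefree u) (hm8 : m₁ % 8 = 5)
    (hDm : J(D | m₁) = 1)
    (hloc : ∀ (l : ℕ) [Fact l.Prime], l ≠ 2 → (l : ℤ) ∣ D → IsSquare (u : ℚ_[l])) :
    ∃ α β δ : ℚ, (u : ℚ) = α ^ 2 - D * (β ^ 2 - p * δ ^ 2) := by
  have hp : p.Prime := hpF.out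
  have hp2 : p ≠ 2 := by rintro rfl; omega
  have hm0 : m₁ ≠ 0 := by rintro rfl; omega
  have hpm : p.Coprime m₁ :=
    Nat.coprime_of_squarefree_mul (by
      rw [hu] at husq
      exact Int.squarefree_natCast.1 (by exact_mod_cast husq))
  have hDm' : IsCoprime D m₁ := by
    rw [Int.isCoprime_iff_gcd_eq_one]
    by_contra hgcd
    have : NeZero m₁ := ⟨hm0⟩
    rw [jacobiSym.eq_zero_iff_not_coprime.2 hgcd] at hDm
    exact zero_ne_one hDm
  have hD0 : D ≠ 0 := by
    rintro rfl
    rw [jacobiSym.zero_left hp.one_lt] at hD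
    exact zero_ne_one hD
  have h8m : Nat.Coprime (8 * p) m₁ := by
    refine Nat.Coprime.mul_left ?_ hpm
    have hodd : Odd m₁ := Nat.odd_iff.2 (by omega)
    exact (Nat.Coprime.pow_left 3 (Nat.coprime_two_left.2 hodd) :)
  obtain ⟨r, hrB, hr, hr1, hr2⟩ := Nat.exists_prime_gt_of_isCoprime (m := 8 * p) (k := m₁) (s := 1)
    (t := D) (mul_ne_zero (by norm_num) hp.ne_zero) hm0 (Nat.isCoprime_iff_coprime.2 h8m)
    isCoprime_one_left
    hDm' (D.natAbs + p + 2)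
  have hrF : Fact r.Prime := ⟨hr⟩
  have hr_two : r ≠ 2 := by omega
  push_cast at hr1
  have hr8 : r % 8 = 1 := by
    have := (dvd_mul_right 8 (p : ℤ)).trans hr1
    omega
  have hrp : (p : ℤ) ∣ r - 1 := (dvd_mul_left (p : ℤ) 8).trans hr1
  have hJrp : J(r | p) = 1 := by
    rw [jacobiSym.mod_left' (Int.emod_eq_emod_iff_emod_sub_eq_zero.2 (Int.emod_eq_zero_of_dvd hrp)),
      jacobiSym.one_left]
  have hJpr : J(p | r) = 1 := by
    rw [jacobiSym.quadratic_reciprocity_one_mod_four (by omega) (hr.odd_of_ne_two hr_two), hJrp]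
  have hJmr : J(m₁ | r) = 1 := by
    rw [jacobiSym.quadratic_reciprocity_one_mod_four' (Nat.odd_iff.2 (by omega)) (by omega),
      jacobiSym.mod_left' (Int.emod_eq_emod_iff_emod_sub_eq_zero.2 (Int.emod_eq_zero_of_dvd hr2)),
      hDm]
  have hprime_dvd : ∀ l q : ℕ, l.Prime → q.Prime → l ∣ q → l = q :=
    fun l q hl hq h => (Nat.prime_dvd_prime_iff_eq hl hq).1 h
  have hc1 : HasConicPoint ((p : ℤ) : ℚ) ((r : ℤ) : ℚ) := by
    refine HasConicPoint.rat_of_int (by exact_mod_cast hp.ne_zero) (by exact_mod_cast hr.ne_zero)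
      (by omega) fun l hl hl2 => ?_
    by_cases hlp : l = p
    · subst hlp
      exact .inr (.inr (Padic.isSquare_intCast_of_jacobiSym hl2 hJrp))
    by_cases hlr : l = r
    · subst hlr
      exact .inr (.inl (Padic.isSquare_intCast_of_jacobiSym hl2 hJpr))
    refine .inl ⟨fun h => hlp ?_, fun h => hlr ?_⟩
    · exact hprime_dvd l p hl.out hp (by exact_mod_cast h)
    · exact hprime_dvd l r hl.out hr (by exact_mod_cast h)
  have hc2 : HasConicPoint (u : ℚ) ((D * r : ℤ) : ℚ) := by
    refine HasConicPoint.rat_of_int husq.ne_zero (mul_ne_zero hD0 (by exact_mod_cast hr.ne_zero))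
      (by rw [hu]; rintro ⟨h, -⟩; exact absurd h (not_lt.2 (by positivity))) fun l hl hl2 => ?_
    have hlprime : Prime (l : ℤ) := Nat.prime_iff_prime_int.1 hl.out
    by_cases hlp : l = p
    · subst hlp
      refine .inr (.inr (Padic.isSquare_intCast_of_jacobiSym hl2 ?_))
      rw [jacobiSym.mul_left, hD, hJrp, one_mul]
    by_cases hlr : l = r
    · subst hlr
      refine .inr (.inl (Padic.isSquare_intCast_of_jacobiSym hl2 ?_))
      rw [hu, jacobiSym.mul_left, hJpr, hJmr, one_mul]
    by_cases hlD : (l : ℤ) ∣ D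
    · exact .inr (.inl (hloc l hl2 hlD))
    by_cases hlm : (l : ℤ) ∣ m₁
    · have hlr' : (l : ℤ) ∣ r - D := hlm.trans hr2
      refine .inr (.inr (Padic.isSquare_intCast hl2 (fun h => ?_) ⟨(D : ZMod l), ?_⟩))
      · rcases hlprime.dvd_or_dvd h with h | h
        · exact hlD h
        · exact hlr (hprime_dvd l r hl.out hr (by exact_mod_cast h))
      · rw [← Int.cast_mul, ZMod.intCast_eq_intCast_iff_dvd_sub]
        have : D * D - D * r = -(D * (r - D)) := by ring
        rw [this]
        exact (hlr'.mul_left D).neg_right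
    · refine .inl ⟨fun h => ?_, fun h => ?_⟩
      · rw [hu] at h
        rcases hlprime.dvd_or_dvd h with h | h
        · exact hlp (hprime_dvd l p hl.out hp (by exact_mod_cast h))
        · exact hlm h
      · rcases hlprime.dvd_or_dvd h with h | h
        · exact hlD h
        · exact hlr (hprime_dvd l r hl.out hr (by exact_mod_cast h))
  have hp_nsq : ¬IsSquare ((p : ℤ) : ℚ) := by
    refine Rat.not_isSquare_intCast_of_dvd hp dvd_rfl fun h => ?_
    have := Nat.le_of_dvd hp.pos (by exact_mod_cast h : p ^ 2 ∣ p)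
    have := hp.two_le
    nlinarith
  have hDr_nsq : ¬IsSquare ((D * r : ℤ) : ℚ) := by
    refine Rat.not_isSquare_intCast_of_dvd hr (dvd_mul_left _ _) fun h => ?_
    rw [sq] at h
    have h := Int.dvd_of_mul_dvd_mul_right (by exact_mod_cast hr.ne_zero) h
    have := Int.le_of_dvd (abs_pos.2 hD0) ((dvd_abs _ _).2 h)
    rw [Int.abs_eq_natAbs] at this
    omega
  obtain ⟨b, d, hbd⟩ := hc1.exists_eq_sq_sub hp_nsq
  obtain ⟨a, c, hac⟩ := hc2.symm.exists_eq_sq_sub hDr_nsq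
  refine ⟨a, b * c, d * c, ?_⟩
  push_cast at hbd hac
  rw [hac, hbd]
  ring

theorem isSquare_squarefree_part_of_local {l : ℕ} [Fact l.Prime] {x₀ m : ℤ} {x s a M r : ℚ}
    (hM : M = m * r ^ 2) (hM0 : M ≠ 0) (hx₀ : Squarefree x₀) (hx : x = x₀ * s ^ 2)
    (hx2 : ¬2 ∣ x.den) (hl : l = 2 ∨ l ≠ 2 ∧ (l : ℤ) ∣ x₀) (ha : ¬l ∣ a.den)
    (h : M = (1 + x ^ 2) ^ 2 + 32 * x * a ∨ M = (1 + x ^ 2) ^ 2 + 64 * x ^ 2 * a) :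
    IsSquare (m : ℚ_[l]) := by
  have hr : (r : ℚ_[l]) ≠ 0 := by
    rw [Rat.cast_ne_zero]
    rintro rfl
    simp at hM
    exact hM0 hM
  have key := Padic.isSquare_one_add_sq_sq_add (l := l) (x := (x : ℚ_[l])) (a := a)
    (Padic.norm_rat_le_one ha) (by
      rcases hl with rfl | ⟨hl, hd⟩
      · exact .inr ⟨rfl, Padic.norm_rat_le_one hx2⟩
      · refine .inl ⟨hl, ?_⟩
        rw [hx]
        push_cast
        exact Padic.norm_mul_sq_ne_one_of_squarefree hx₀ hd _)
  rw [← Padic.isSquare_mul_sq_iff hr]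
  have hcast : (m : ℚ_[l]) * (r : ℚ_[l]) ^ 2 = (M : ℚ_[l]) := by rw [hM]; push_cast; rfl
  rw [hcast]
  rcases h with h | h
  · have := key.1
    rw [h]; push_cast; exact this
  · have := key.2
    rw [h]; push_cast; exact this

theorem exists_eq_sq_sub_two_mul {x₀ ε : ℤ} {k c p : ℕ} {s x : ℚ} [hpF : Fact p.Prime]
    (hx₀ : Squarefree x₀) (hε : ε = 1 ∨ ε = -1) (hc : Odd c) (hxc : x₀ = ε * 2 ^ k * c)
    (hs : s ≠ 0) (hx : x = x₀ * s ^ 2) (hx2 : ¬2 ∣ x.den) (hp8 : p % 8 = 5)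
    (hpx : ‖(x : ℚ_[p])‖ = 1) (hJ : J(2 * x₀ | p) = 1) :
    ∃ α β δ : ℚ, (1 + x ^ 2) ^ 2 + 64 * x ^ 2 * ((p ^ 2 + 1) ^ 2 / p) =
      α ^ 2 - 2 * x * (β ^ 2 - p * δ ^ 2) := by
  have hp : p.Prime := hpF.out
  have hp0 : (0 : ℚ) < p := by exact_mod_cast hp.pos
  have hp2 : p ≠ 2 := by rintro rfl; omega
  set m : ℚ := (1 + x ^ 2) ^ 2 + 64 * x ^ 2 * ((p ^ 2 + 1) ^ 2 / p) with hm
  have hmpos : 0 < m := by positivity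
  obtain ⟨u, r, husq, hr, hmu⟩ := Rat.exists_squarefree_mul_sq hmpos.ne'
  have hr2 : 0 < r ^ 2 := by positivity
  have hupos : 0 < u := by
    rw [hmu] at hmpos
    exact_mod_cast (pos_iff_pos_of_mul_pos hmpos).2 hr2
  have hloc : ∀ (l : ℕ) [Fact l.Prime], l = 2 ∨ l ≠ 2 ∧ (l : ℤ) ∣ x₀ → l ≠ p →
      IsSquare (u : ℚ_[l]) := fun l hl hl2 hlp => by
    refine isSquare_squarefree_part_of_local hmu hmpos.ne' hx₀ hx hx2 hl2 ?_ (.inr hm)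
    intro hd
    have hden : ((p ^ 2 + 1) ^ 2 / p : ℚ).den ∣ p := by
      rw [show ((p ^ 2 + 1) ^ 2 / p : ℚ) = ((((p : ℤ) ^ 2 + 1) ^ 2 : ℤ) : ℚ) / ((p : ℤ) : ℚ) by
        push_cast; rfl, ← Rat.divInt_eq_div]
      exact Int.natCast_dvd_natCast.1 (Rat.den_dvd _ _)
    exact hlp ((Nat.prime_dvd_prime_iff_eq hl.out hp).1 (hd.trans hden))
  have hpD : ¬(p : ℤ) ∣ x₀ := fun hd => by
    rw [jacobiSym.mod_left, Int.emod_eq_zero_of_dvd (hd.mul_left 2),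
      jacobiSym.zero_left hp.one_lt] at hJ
    exact zero_ne_one hJ
  have hpp : Prime (p : ℤ) := Nat.prime_iff_prime_int.1 hp
  have hpu : (p : ℤ) ∣ u := by
    by_contra hnd
    have hsq : Squarefree ((p : ℤ) * u) := by
      exact squarefree_mul_iff.2 ⟨(hpp.coprime_iff_not_dvd.2 hnd).isRelPrime, hpp.squarefree, husq⟩
    refine Padic.not_dvd_of_isSquare_of_squarefree (p := p) hsq ?_ (dvd_mul_right _ _)
    rw [← Padic.isSquare_mul_sq_iff (s := (r : ℚ_[p])) (by exact_mod_cast hr)]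
    have hcast : (((p : ℤ) * u : ℤ) : ℚ_[p]) * (r : ℚ_[p]) ^ 2 =
        (8 * x * (p ^ 2 + 1)) ^ 2 + p * (1 + x ^ 2) ^ 2 := by
      have : (p * u : ℚ) * r ^ 2 = (8 * x * (p ^ 2 + 1)) ^ 2 + p * (1 + x ^ 2) ^ 2 := by
        rw [mul_assoc, ← hmu, hm]
        field_simp
        ring
      exact_mod_cast congrArg (Rat.cast : ℚ → ℚ_[p]) this
    rw [hcast]
    apply Padic.isSquare_sq_add_of_norm_lt
    have hp21 : ‖(p ^ 2 + 1 : ℚ_[p])‖ = 1 := by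
      have : ‖(((p : ℤ) ^ 2 + 1 : ℤ) : ℚ_[p])‖ = 1 :=
        Padic.norm_intCast_eq_one_iff.2 ⟨1, -p, by ring⟩
      simpa using this
    have h8 : ‖(8 : ℚ_[p])‖ = 1 := by
      rw [show (8 : ℚ_[p]) = 2 ^ 3 by norm_num, norm_pow, Padic.norm_two_of_ne hp2, one_pow]
    have hP : ‖(1 + x ^ 2 : ℚ_[p])‖ ≤ 1 := by
      refine (Padic.nonarchimedean _ _).trans (max_le (by simp) ?_)
      rw [norm_pow, hpx, one_pow]
    rw [norm_mul, norm_mul, norm_mul, h8, hpx, hp21, Padic.norm_two_of_ne hp2, norm_pow]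
    have := Padic.norm_p_lt_one (p := p)
    have := norm_nonneg (p : ℚ_[p])
    have : ‖(1 + x ^ 2 : ℚ_[p])‖ ^ 2 ≤ 1 := pow_le_one₀ (norm_nonneg _) hP
    nlinarith
  obtain ⟨m₁, hum⟩ := hpu
  lift m₁ to ℕ using
    ((pos_iff_pos_of_mul_pos (hum ▸ hupos)).1 (by exact_mod_cast hp.pos)).le with m₁
  have : Fact (Nat.Prime 2) := ⟨Nat.prime_two⟩
  have hu8 : u % 8 = 1 := Padic.emod_eight_of_isSquare_of_squarefree husq
    (hloc 2 (.inl rfl) (Ne.symm hp2))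
  have hu8' : (p * m₁) % 8 = 1 := by
    rw [hum] at hu8; exact_mod_cast hu8
  have hm8 : m₁ % 8 = 5 := by
    rw [Nat.mul_mod, hp8] at hu8'
    omega
  have hDm : J(2 * x₀ | m₁) = 1 := by
    have hDu : J(2 * x₀ | p * m₁) = 1 := by
      have : 2 * x₀ = ε * 2 ^ (k + 1) * c := by rw [hxc]; ring
      rw [this, jacobiSym.sign_mul_two_pow_mul hε _ hc (by omega),
        jacobiSym.two_of_mod_eight_eq_one hu8', one_pow, one_mul]
      refine jacobiSym.eq_one_of_forall_isSquare fun l hl hlc => ?_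
      have : Fact l.Prime := ⟨hl⟩
      have hlx : (l : ℤ) ∣ x₀ := by
        rw [hxc]
        exact (Int.natCast_dvd_natCast.2 hlc).mul_left _
      have hsq : IsSquare (u : ℚ_[l]) := by
        refine hloc l (.inr ⟨?_, hlx⟩) ?_
        · rintro rfl
          exact absurd (hc.of_dvd_nat hlc) (by decide)
        · rintro rfl
          exact hpD hlx
      rw [show ((p * m₁ : ℕ) : ℤ) = u by rw [hum]; push_cast; rfl]
      exact ⟨Padic.isSquare_zmod_of_isSquare hsq, Padic.not_dvd_of_isSquare_of_squarefree husq hsq⟩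
    have : NeZero p := ⟨hp.ne_zero⟩
    have : NeZero m₁ := ⟨by rintro rfl; omega⟩
    rwa [jacobiSym.mul_right, hJ, one_mul] at hDu
  obtain ⟨α, β, δ, h⟩ := exists_eq_sq_sub_two_mul_of_local hp8 hJ hum husq hm8 hDm
    fun l hl hl2 hd => by
      have hlx : (l : ℤ) ∣ x₀ := ((Nat.prime_iff_prime_int.1 hl.out).dvd_or_dvd hd).resolve_left
        fun h => hl2 ((Nat.prime_dvd_prime_iff_eq hl.out Nat.prime_two).1 (by exact_mod_cast h))
      exact hloc l (.inr ⟨hl2, hlx⟩) (by rintro rfl; exact hpD hlx)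
  refine ⟨α * r, β * r / s, δ * r / s, ?_⟩
  rw [hmu, h, hx]
  push_cast
  field_simp

theorem exists_eq_sq_sub_of_dvd_sub_one {m : ℤ} {p : ℕ} [hpF : Fact p.Prime] (hp4 : p % 4 = 1)
    (hm : Odd m) (hpm : (m.natAbs : ℤ) ∣ p - 1) : ∃ α β : ℚ, (m : ℚ) = α ^ 2 - p * β ^ 2 := by
  have hp : p.Prime := hpF.out
  have hJ1 : J(p | m.natAbs) = 1 := by
    rw [jacobiSym.mod_left' (Int.emod_eq_emod_iff_emod_sub_eq_zero.2 (Int.emod_eq_zero_of_dvd hpm)),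
      jacobiSym.one_left]
  have hJ : J(m | p) = 1 := by
    obtain ⟨ε, hε, hmε⟩ : ∃ ε : ℤ, (ε = 1 ∨ ε = -1) ∧ m = ε * 2 ^ 0 * m.natAbs := by
      rcases Int.natAbs_eq m with h | h
      · exact ⟨1, .inl rfl, by simpa using h⟩
      · exact ⟨-1, .inr rfl, by simpa using h⟩
    rw [hmε, jacobiSym.sign_mul_two_pow_mul hε 0 (Int.natAbs_odd.2 hm) hp4, pow_zero, one_mul, hJ1]
  have hc : HasConicPoint ((p : ℤ) : ℚ) (m : ℚ) := by
    refine HasConicPoint.rat_of_int (by exact_mod_cast hp.ne_zero)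
      (by rintro rfl; exact absurd hm (by decide)) (by omega) fun l hl hl2 => ?_
    by_cases hlp : l = p
    · subst hlp
      exact .inr (.inr (Padic.isSquare_intCast_of_jacobiSym hl2 hJ))
    by_cases hlm : (l : ℤ) ∣ m
    · refine .inr (.inl (Padic.isSquare_intCast_of_jacobiSym hl2 ?_))
      rw [jacobiSym.mod_left' (Int.emod_eq_emod_iff_emod_sub_eq_zero.2
        (Int.emod_eq_zero_of_dvd ((Int.dvd_natAbs.2 hlm).trans hpm))), jacobiSym.one_left]
    · exact .inl ⟨fun h => hlp
        ((Nat.prime_dvd_prime_iff_eq hl.out hp).1 (by exact_mod_cast h)), hlm⟩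
  refine hc.exists_eq_sq_sub (Rat.not_isSquare_intCast_of_dvd hp dvd_rfl fun h => ?_)
  have := Nat.le_of_dvd hp.pos (by exact_mod_cast h : p ^ 2 ∣ p)
  have := hp.two_le
  nlinarith

theorem exists_squarefree_part_of_local {x₀ : ℤ} {x s a M : ℚ} (hx₀ : Squarefree x₀)
    (hx : x = x₀ * s ^ 2) (hx2 : ¬2 ∣ x.den) (ha : a.den = 1)
    (hM : M = (1 + x ^ 2) ^ 2 + 32 * x * a) :
    ∃ (m : ℤ) (r : ℚ), M = m * r ^ 2 ∧ Odd m ∧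
      ∀ l : ℕ, l.Prime → l ≠ 2 → (l : ℤ) ∣ x₀ → ¬(l : ℤ) ∣ m := by
  by_cases hM0 : M = 0
  · refine ⟨1, 0, by simp [hM0], odd_one, fun l hl _ _ h => hl.one_lt.ne' ?_⟩
    exact Nat.dvd_one.1 (by exact_mod_cast h)
  obtain ⟨m, r, hm, -, hMm⟩ := Rat.exists_squarefree_mul_sq hM0
  have key : ∀ l : ℕ, l.Prime → l = 2 ∨ l ≠ 2 ∧ (l : ℤ) ∣ x₀ → ¬(l : ℤ) ∣ m := fun l hl h => by
    have : Fact l.Prime := ⟨hl⟩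
    refine Padic.not_dvd_of_isSquare_of_squarefree hm
      (isSquare_squarefree_part_of_local hMm hM0 hx₀ hx hx2 h ?_ (.inl hM))
    rw [ha]
    exact hl.one_lt.ne' ∘ Nat.dvd_one.1
  refine ⟨m, r, hMm, ?_, fun l hl hl2 hd => key l hl (.inr ⟨hl2, hd⟩)⟩
  have := key 2 Nat.prime_two (.inl rfl)
  rw [← Int.not_even_iff_odd, even_iff_two_dvd]
  exact_mod_cast this

theorem exists_prime_and_eq_sq_sub (n : ℤ) {x : ℚ} (hx2 : ¬2 ∣ x.den)
    (hx : ∀ z : ℚ, x ≠ z ^ 2 ∧ x ≠ -z ^ 2 ∧ x ≠ 2 * z ^ 2 ∧ x ≠ -(2 * z ^ 2)) :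
    ∃ p : ℕ, p.Prime ∧ p % 8 = 5 ∧
      (∃ α β : ℚ, (1 + x ^ 2) ^ 2 + 32 * x * n ^ 2 = α ^ 2 - p * β ^ 2) ∧
      ∃ α β δ : ℚ, (1 + x ^ 2) ^ 2 + 64 * x ^ 2 * ((p ^ 2 + 1) ^ 2 / p) =
        α ^ 2 - 2 * x * (β ^ 2 - p * δ ^ 2) := by
  obtain ⟨x₀, s, hx₀, hs, hxs⟩ := Rat.exists_squarefree_mul_sq (r := x)
    (fun h0 => (hx 0).1 (by simp [h0]))
  obtain ⟨ε, k, l, w, hε, hl, hl2, hw, hlw, hxε⟩ := Int.exists_eq_sign_mul_two_pow_mul hx₀ (by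
    obtain ⟨h1, h2, h3, h4⟩ := hx s
    refine ⟨?_, ?_, ?_, ?_⟩ <;> rintro rfl <;> norm_num at hxs <;> contradiction)
  obtain ⟨m, r, hMm, hmodd, hmd⟩ := exists_squarefree_part_of_local (a := (n : ℚ) ^ 2) hx₀ hxs hx2
    (by rw [← Int.cast_pow]; exact Rat.den_intCast _) rfl
  have hlx : (l : ℤ) ∣ x₀ := by
    rw [hxε]; push_cast
    exact (dvd_mul_right (l : ℤ) w).mul_left _
  have hlm : l.Coprime (m.natAbs * w) := Nat.Coprime.mul_right
    (hl.coprime_iff_not_dvd.2 fun h => hmd l hl hl2 hlx (Int.natCast_dvd.2 h)) hlw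
  obtain ⟨p, hpB, hp, hp8, hpm, hpl⟩ := Nat.exists_prime_mod_eight_eq_five
    ((Int.natAbs_odd.2 hmodd).mul hw) hl hl2 hlm (neg_one_pow_eq_or ℤ (k + 1))
    (x.num.natAbs + x.den)
  have : Fact p.Prime := ⟨hp⟩
  rw [Nat.cast_mul] at hpm
  have hlwodd : Odd (l * w) := (hl.odd_of_ne_two hl2).mul hw
  refine ⟨p, hp, hp8, ?_, ?_⟩
  · obtain ⟨α, β, h⟩ := exists_eq_sq_sub_of_dvd_sub_one (p := p) (by omega) hmodd
      ((dvd_mul_right _ (w : ℤ)).trans hpm)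
    refine ⟨α * r, β * r, ?_⟩
    rw [hMm, h]
    ring
  · refine exists_eq_sq_sub_two_mul hx₀ hε hlwodd hxε hs hxs hx2 hp8 ?_ ?_
    · refine Padic.norm_ratCast_eq_one (fun h => ?_) fun h => ?_
      · have h0 : x.num ≠ 0 := Rat.num_ne_zero.2 fun h0 => (hx 0).1 (by simp [h0])
        have := Nat.le_of_dvd (Int.natAbs_pos.2 h0) (Int.natCast_dvd.1 h)
        omega
      · have := Nat.le_of_dvd x.den_pos h
        omega
    · have hJw : J(p | w) = 1 := by
        rw [jacobiSym.mod_left' (Int.emod_eq_emod_iff_emod_sub_eq_zero.2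
          (Int.emod_eq_zero_of_dvd ((dvd_mul_left (w : ℤ) _).trans hpm))), jacobiSym.one_left]
      have : NeZero l := ⟨hl.ne_zero⟩
      have : NeZero w := ⟨hw.pos.ne'⟩
      rw [show 2 * x₀ = ε * 2 ^ (k + 1) * (l * w : ℕ) by rw [hxε]; ring,
        jacobiSym.sign_mul_two_pow_mul hε _ hlwodd (by omega),
        jacobiSym.two_of_mod_eight_eq_five hp8, jacobiSym.mul_right, hpl, hJw, mul_one,
        ← mul_pow]
      norm_num

end

/-- The set of odd primes. -/
def oddPrimes : Set ℕ :=
  {p | p.Prime ∧ p ≠ 2}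

theorem mem_ringOfPrimes_oddPrimes {x : ℚ} : x ∈ ringOfPrimes oddPrimes ↔ ¬2 ∣ x.den :=
  ⟨fun h hd => (h 2 Nat.prime_two hd).2 rfl,
    fun h p hp hd => ⟨hp, by rintro rfl; exact h hd⟩⟩

theorem hasNatDensity_oddPrimes : HasNatDensity oddPrimes 1 := by
  have hcard (X : ℕ) : (primesUpTo Set.univ X).card = Nat.primeCounting X := by
    rw [Nat.primeCounting, Nat.primeCounting', Nat.count_eq_card_filter_range, primesUpTo]
    congr 1
    ext p
    simp
  have herase (X : ℕ) (hX : 2 ≤ X) : (primesUpTo oddPrimes X).card + 1 = Nat.primeCounting X := by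
    rw [← hcard, ← Finset.card_erase_add_one (a := 2) (s := primesUpTo Set.univ X)]
    · congr 2
      ext p
      simp [primesUpTo, oddPrimes]
      tauto
    · simp [primesUpTo, Nat.prime_two]
      omega
  have htop : Filter.Tendsto (fun X : ℕ => (Nat.primeCounting X : ℝ)) Filter.atTop Filter.atTop :=
    tendsto_natCast_atTop_atTop.comp Nat.tendsto_primeCounting
  have hlim : Filter.Tendsto (fun X : ℕ => 1 - (Nat.primeCounting X : ℝ)⁻¹) Filter.atTop
      (nhds 1) := by
    simpa using tendsto_const_nhds.sub htop.inv_tendsto_atTop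
  refine hlim.congr' ?_
  filter_upwards [Filter.eventually_ge_atTop 2] with X hX
  have h := herase X hX
  have h0 : (Nat.primeCounting X : ℝ) ≠ 0 := by
    rw [← h]
    positivity
  rw [hcard, eq_div_iff h0, sub_mul, inv_mul_cancel₀ h0, one_mul, ← h]
  push_cast
  ring

/-- The quantifier-free part of the formula defining `ℤ`. -/
def formulaValue {R : Type*} [CommRing R] (t x h w f a b a' b' d' z : R) : R :=
  (x - z ^ 2) * (x + z ^ 2) * (x - 2 * z ^ 2) * (x + 2 * z ^ 2) *
    (((5 + 8 * w) * f - 1) ^ 2 +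
      (a ^ 2 - (5 + 8 * w) * b ^ 2 - h ^ 2 * ((1 + x ^ 2) ^ 2 + 32 * x * t ^ 2)) ^ 2 +
      (a' ^ 2 - 2 * x * b' ^ 2 + 2 * x * (5 + 8 * w) * d' ^ 2 -
        h ^ 2 * ((1 + x ^ 2) ^ 2 + 64 * x ^ 2 * ((5 + 8 * w) ^ 2 + 1) ^ 2 * f)) ^ 2)

theorem map_formulaValue {R S : Type*} [CommRing R] [CommRing S] (φ : R →+* S)
    (t x h w f a b a' b' d' z : R) :
    φ (formulaValue t x h w f a b a' b' d' z) =
      formulaValue (φ t) (φ x) (φ h) (φ w) (φ f) (φ a) (φ b) (φ a') (φ b') (φ d') (φ z) := by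
  simp [formulaValue, map_ofNat]

open MvPolynomial in
/-- The polynomial of the formula defining `ℤ`; its last twelve variables are the existentially
quantified ones. -/
noncomputable def formulaPolynomial : MvPolynomial (Fin 2 ⊕ Fin 12) ℤ :=
  let y (i : Fin 12) : MvPolynomial (Fin 2 ⊕ Fin 12) ℤ := X (.inr i)
  formulaValue (X (.inl 0)) (X (.inl 1)) (1 + y 0 ^ 2 + y 1 ^ 2 + y 2 ^ 2 + y 3 ^ 2)
    (y 4) (y 5) (y 6) (y 7) (y 8) (y 9) (y 10) (y 11)

theorem aeval_formulaPolynomial {R : Type*} [CommRing R] (t x : R) (y : Fin 12 → R) :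
    MvPolynomial.aeval (Sum.elim ![t, x] y) formulaPolynomial =
      formulaValue t x (1 + y 0 ^ 2 + y 1 ^ 2 + y 2 ^ 2 + y 3 ^ 2)
        (y 4) (y 5) (y 6) (y 7) (y 8) (y 9) (y 10) (y 11) := by
  rw [formulaPolynomial, ← AlgHom.coe_toRingHom, map_formulaValue]
  simp

theorem formulaValue_eq_zero_iff {K : Type*} [Field K] [LinearOrder K] [IsStrictOrderedRing K]
    {t x h w f a b a' b' d' z : K} :
    formulaValue t x h w f a b a' b' d' z = 0 ↔
      (x = z ^ 2 ∨ x = -z ^ 2 ∨ x = 2 * z ^ 2 ∨ x = -(2 * z ^ 2)) ∨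
      (5 + 8 * w) * f = 1 ∧
        a ^ 2 - (5 + 8 * w) * b ^ 2 = h ^ 2 * ((1 + x ^ 2) ^ 2 + 32 * x * t ^ 2) ∧
        a' ^ 2 - 2 * x * b' ^ 2 + 2 * x * (5 + 8 * w) * d' ^ 2 =
          h ^ 2 * ((1 + x ^ 2) ^ 2 + 64 * x ^ 2 * ((5 + 8 * w) ^ 2 + 1) ^ 2 * f) := by
  have hsq (u v w : K) : u ^ 2 + v ^ 2 + w ^ 2 = 0 ↔ u = 0 ∧ v = 0 ∧ w = 0 := by
    rw [add_eq_zero_iff_of_nonneg (by positivity) (sq_nonneg w),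
      add_eq_zero_iff_of_nonneg (sq_nonneg u) (sq_nonneg v)]
    simp only [pow_eq_zero_iff two_ne_zero, and_assoc]
  rw [formulaValue, mul_eq_zero, mul_eq_zero, mul_eq_zero, mul_eq_zero, hsq]
  simp only [sub_eq_zero, add_eq_zero_iff_eq_neg, or_assoc]

theorem Rat.not_two_dvd_den_of_eq_mul_sq {k : ℤ} (hk : ¬4 ∣ k) {x z : ℚ} (hx : ¬2 ∣ x.den)
    (h : x = k * z ^ 2) : ¬2 ∣ z.den := by
  rintro ⟨c, hc⟩
  have hnum : ¬(2 : ℤ) ∣ z.num := fun hd =>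
    Nat.not_coprime_of_dvd_of_dvd one_lt_two (Int.natCast_dvd.1 hd) ⟨c, hc⟩ z.reduced
  have hz : (z.den : ℚ) ≠ 0 := by exact_mod_cast z.den_ne_zero
  have hxd : (x.den : ℚ) ≠ 0 := by exact_mod_cast x.den_ne_zero
  have heq : x.num * z.den ^ 2 = k * (z.num ^ 2 * x.den) := by
    rw [← Rat.num_div_den x, ← Rat.num_div_den z] at h
    field_simp at h
    have : (x.num * z.den ^ 2 : ℚ) = k * (z.num ^ 2 * x.den) := by linear_combination h
    exact_mod_cast this
  have hodd : IsCoprime (4 : ℤ) (z.num ^ 2 * x.den) := by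
    have h2 : IsCoprime (2 : ℤ) (z.num ^ 2 * x.den) :=
      (((Int.prime_two.coprime_iff_not_dvd).2 hnum).pow_right).mul_right
        ((Int.prime_two.coprime_iff_not_dvd).2 (by exact_mod_cast hx))
    exact (h2.pow_left (m := 2) :)
  refine hk (hodd.dvd_of_dvd_mul_right (heq ▸ ?_))
  rw [hc]
  exact ⟨x.num * c ^ 2, by push_cast; ring⟩

theorem Rat.exists_common_denominator {ι : Type*} [Fintype ι] (v : ι → ℚ) :
    ∃ H : ℕ, H ≠ 0 ∧ ∃ m : ι → ℤ, ∀ i, (m i : ℚ) = H * v i := by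
  have hdvd (i : ι) : (v i).den ∣ ∏ j, (v j).den := Finset.dvd_prod_of_mem _ (Finset.mem_univ i)
  choose c hc using hdvd
  refine ⟨∏ j, (v j).den, Finset.prod_ne_zero_iff.2 fun j _ => (v j).den_ne_zero,
    fun i => c i * (v i).num, fun i => ?_⟩
  have hv : (v i).den * v i = (v i).num := by
    rw [mul_comm, Rat.mul_den_eq_num]
  rw [hc i]
  push_cast
  linear_combination -(c i : ℚ) * hv

theorem exists_formula_witness (n : ℤ) {x : ℚ} (hx2 : ¬2 ∣ x.den)
    (hx : ∀ z : ℚ, x ≠ z ^ 2 ∧ x ≠ -z ^ 2 ∧ x ≠ 2 * z ^ 2 ∧ x ≠ -(2 * z ^ 2)) :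
    ∃ (H : ℕ) (w : ℤ) (f : ℚ) (m : Fin 5 → ℤ), H ≠ 0 ∧ ¬2 ∣ f.den ∧
      formulaValue (n : ℚ) x H w f (m 0) (m 1) (m 2) (m 3) (m 4) 0 = 0 := by
  obtain ⟨p, hp, hp8, ⟨α, β, hA⟩, α', β', δ', hB⟩ := exists_prime_and_eq_sq_sub n hx2 hx
  obtain ⟨H, hH, m, hm⟩ := Rat.exists_common_denominator ![α, β, α', β', δ']
  have hp0 : (p : ℚ) ≠ 0 := by exact_mod_cast hp.ne_zero
  have hpw : (5 + 8 * ((p / 8 : ℕ) : ℤ) : ℚ) = p := by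
    have : 5 + 8 * (p / 8) = p := by omega
    exact_mod_cast this
  have h0 := hm 0
  have h1 := hm 1
  have h2 := hm 2
  have h3 := hm 3
  have h4 := hm 4
  simp only [Matrix.cons_val] at h0 h1 h2 h3 h4
  refine ⟨H, (p / 8 : ℕ), (p : ℚ)⁻¹, m, hH, ?_, formulaValue_eq_zero_iff.2 (.inr ⟨?_, ?_, ?_⟩)⟩
  · rw [Rat.inv_natCast_den_of_pos hp.pos]
    omega
  · rw [hpw, mul_inv_cancel₀ hp0]
  · rw [hpw, h0, h1, hA]
    ring
  · rw [hpw, h2, h3, h4]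
    linear_combination -(H : ℚ) ^ 2 * hB


theorem exists_formulaValue_eq_zero (n : ℤ) (x : ringOfPrimes oddPrimes) :
    ∃ (H : ℕ) (w f a b a' b' d' z : ringOfPrimes oddPrimes), H ≠ 0 ∧
      formulaValue (n : ringOfPrimes oddPrimes) x H w f a b a' b' d' z = 0 := by
  have hx2 := mem_ringOfPrimes_oddPrimes.1 x.2
  have hcoe (H : ℕ) (w f a b a' b' d' z : ringOfPrimes oddPrimes) :=
    map_formulaValue (ringOfPrimes oddPrimes).subtype n x H w f a b a' b' d' z
  simp only [map_natCast, map_intCast, Subring.subtype_apply] at hcoe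
  by_cases hx : ∃ (k : ℤ) (z : ℚ), (k = 1 ∨ k = -1 ∨ k = 2 ∨ k = -2) ∧ (x : ℚ) = k * z ^ 2
  · obtain ⟨k, z, hk, hxz⟩ := hx
    have hz := Rat.not_two_dvd_den_of_eq_mul_sq (by omega) hx2 hxz
    refine ⟨1, 0, 0, 0, 0, 0, 0, 0, ⟨z, mem_ringOfPrimes_oddPrimes.2 hz⟩, one_ne_zero, ?_⟩
    rw [← ZeroMemClass.coe_eq_zero, hcoe, formulaValue_eq_zero_iff, hxz]
    left
    rcases hk with rfl | rfl | rfl | rfl <;> simp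
  · push Not at hx
    obtain ⟨H, w, f, m, hH, hf, h⟩ := exists_formula_witness n hx2 fun z =>
      ⟨by simpa using hx 1 z (by simp), by simpa using hx (-1) z (by simp),
        by simpa using hx 2 z (by simp), by simpa using hx (-2) z (by simp)⟩
    refine ⟨H, w, ⟨f, mem_ringOfPrimes_oddPrimes.2 hf⟩, m 0, m 1, m 2, m 3, m 4, 0, hH, ?_⟩
    rw [← ZeroMemClass.coe_eq_zero, hcoe]
    simpa using h

theorem exists_int_eq_of_forall_exists {t : ringOfPrimes oddPrimes}
    (h : ∀ x : ringOfPrimes oddPrimes, ∃ s₁ s₂ s₃ s₄ w f a b a' b' d' z : ringOfPrimes oddPrimes,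
      formulaValue t x (1 + s₁ ^ 2 + s₂ ^ 2 + s₃ ^ 2 + s₄ ^ 2) w f a b a' b' d' z = 0) :
    ∃ n : ℤ, (t : ℚ) = n := by
  by_contra! hn
  have hden : (t : ℚ).den ≠ 1 := fun h1 => hn _ ((Rat.den_eq_one_iff _).1 h1).symm
  obtain ⟨q, hq, hqt⟩ := Nat.exists_prime_and_dvd hden
  have hq2 := (t.2 q hq hqt).2
  have hqpos : (0 : ℚ) < q := by exact_mod_cast hq.pos
  obtain ⟨s₁, s₂, s₃, s₄, w, f, a, b, a', b', d', z, h⟩ := h q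
  rw [← ZeroMemClass.coe_eq_zero, ← Subring.subtype_apply, map_formulaValue,
    formulaValue_eq_zero_iff] at h
  simp only [map_natCast, map_add, map_pow, map_one, Subring.subtype_apply] at h
  have hq_sq : ¬(q : ℤ) ^ 2 ∣ 2 * q := fun hd => by
    rw [sq] at hd
    have hd := Int.dvd_of_mul_dvd_mul_right (by exact_mod_cast hq.ne_zero) hd
    exact hq2 ((Nat.prime_dvd_prime_iff_eq hq Nat.prime_two).1 (by exact_mod_cast hd))
  rcases h with (h | h | h | h) | ⟨hf, hA, hB⟩
  · refine Rat.not_isSquare_intCast_of_dvd hq dvd_rfl (fun hd => hq_sq (hd.mul_left 2))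
      ⟨(z : ℚ), ?_⟩
    push_cast
    rw [h, sq]
  · linarith [sq_nonneg (z : ℚ)]
  · refine Rat.not_isSquare_intCast_of_dvd hq (dvd_mul_left _ _) hq_sq ⟨2 * (z : ℚ), ?_⟩
    push_cast
    rw [h]
    ring
  · linarith [sq_nonneg (z : ℚ)]
  · exact false_of_dvd_den hq hq2 hqt (mem_ringOfPrimes_oddPrimes.1 w.2) hf (by positivity) hA hB

/-- There is a set `W` of primes of natural density one such that `ℤ` is definable over
`O_{ℚ,W}` by a `∀∃`-formula with a single universal quantifier: there are `k ∈ ℕ` and a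
polynomial `F` over `ℤ` in `2 + k` variables such that for every `t ∈ O_{ℚ,W}`,
`t ∈ ℤ` iff `∀ x ∃ y₁ … y_k, F(t, x, y₁, …, y_k) = 0` holds in `O_{ℚ,W}`. -/
theorem one_universal_quantifier_density_one_ring :
    ∃ W : Set ℕ, (∀ p ∈ W, p.Prime) ∧ HasNatDensity W 1 ∧
      ∃ (k : ℕ) (F : MvPolynomial (Fin 2 ⊕ Fin k) ℤ),
        ∀ t : ringOfPrimes W,
          (∃ n : ℤ, (t : ℚ) = (n : ℚ)) ↔
            ∀ x : ringOfPrimes W, ∃ y : Fin k → ringOfPrimes W,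
              MvPolynomial.aeval (Sum.elim ![t, x] y) F = 0 := by
  refine ⟨oddPrimes, fun p hp => hp.1, hasNatDensity_oddPrimes, 12, formulaPolynomial, fun t =>
    ⟨?_, fun h => exists_int_eq_of_forall_exists fun x => ?_⟩⟩
  · rintro ⟨n, hn⟩ x
    obtain rfl : t = n := Subtype.ext (by simpa using hn)
    obtain ⟨H, w, f, a, b, a', b', d', z, hH, h⟩ := exists_formulaValue_eq_zero n x
    obtain ⟨s₁, s₂, s₃, s₄, hs⟩ := Nat.sum_four_squares (H - 1)
    have hHs : H = 1 + s₁ ^ 2 + s₂ ^ 2 + s₃ ^ 2 + s₄ ^ 2 := by omega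
    refine ⟨![s₁, s₂, s₃, s₄, w, f, a, b, a', b', d', z], ?_⟩
    rw [aeval_formulaPolynomial]
    rw [hHs] at h
    push_cast at h
    exact h
  · obtain ⟨y, hy⟩ := h x
    rw [aeval_formulaPolynomial] at hy
    exact ⟨_, _, _, _, _, _, _, _, _, _, _, _, hy⟩
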